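/- Let m,n ≥ 1 and let ℙ be a Borel regular probability measure on the space 𝒢_{m,n} of MILP instances of size (m,n) such that ℙ[SB(G) ∈ ℝ^n] = 1 and ℙ[G is MP-tractable] = 1. Then for every ε > 0 and every δ > 0 there exists an MP-GNN F of size (m,n) such that ℙ[‖F(G) − SB(G)‖ ≤ δ] ≥ 1 − ε, where ‖·‖ denotes the Euclidean norm on ℝ^n. -/

import Mathlib

open scoped BigOperators Classical
open MeasureTheory

noncomputable section

/-- Type of constraint senses: `0` is `≤`, `1` is `=`, `2` is `≥`. -/
abbrev Sense : Type := Fin 3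

/-- Extended lower bounds: `Sum.inl a` is a real bound, `Sum.inr ()` is `-∞`. -/
abbrev ExtLo : Type := ℝ ⊕ Unit

/-- Extended upper bounds: `Sum.inl a` is a real bound, `Sum.inr ()` is `+∞`. -/
abbrev ExtHi : Type := ℝ ⊕ Unit

def senseRel (s : Sense) (a b : ℝ) : Prop :=
  if s = 0 then a ≤ b else if s = 1 then a = b else b ≤ a

def loSat (lo : ExtLo) (x : ℝ) : Prop :=
  match lo with
  | Sum.inl a => a ≤ x
  | Sum.inr _ => True

def hiSat (hi : ExtHi) (x : ℝ) : Prop :=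
  match hi with
  | Sum.inl a => x ≤ a
  | Sum.inr _ => True

/-- The space `𝒢_{m,n}` of MILP instances of size `(m,n)`:
`(A, b, c, ∘, l, u, I)`, with `I` encoded as a Boolean indicator vector. -/
abbrev MILP (m n : ℕ) : Type :=
  (Fin m → Fin n → ℝ) × (Fin m → ℝ) × (Fin n → ℝ) × (Fin m → Sense) ×
  (Fin n → ExtLo) × (Fin n → ExtHi) × (Fin n → Bool)

namespace MILP

variable {m n : ℕ}

def A (G : MILP m n) : Fin m → Fin n → ℝ := G.1
def b (G : MILP m n) : Fin m → ℝ := G.2.1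
def c (G : MILP m n) : Fin n → ℝ := G.2.2.1
def sense (G : MILP m n) : Fin m → Sense := G.2.2.2.1
def lo (G : MILP m n) : Fin n → ExtLo := G.2.2.2.2.1
def hi (G : MILP m n) : Fin n → ExtHi := G.2.2.2.2.2.1
def isInt (G : MILP m n) : Fin n → Bool := G.2.2.2.2.2.2

end MILP

/-- Satisfaction of the linear constraints `(Ax) ∘ b`. -/
def consSat {m n : ℕ} (G : MILP m n) (x : Fin n → ℝ) : Prop :=
  ∀ i, senseRel (MILP.sense G i) (∑ j, MILP.A G i j * x j) (MILP.b G i)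

/-- Feasible set of the LP relaxation of `G`. -/
def lpFeasSet {m n : ℕ} (G : MILP m n) : Set (Fin n → ℝ) :=
  {x | consSat G x ∧ ∀ j, loSat (MILP.lo G j) (x j) ∧ hiSat (MILP.hi G j) (x j)}

/-- Feasible set of `LP(G, j, lo', hi')`: the LP relaxation of `G` with the bound
constraint on variable `j` replaced by `lo' ≤ x_j ≤ hi'`. -/
def feasSetMod {m n : ℕ} (G : MILP m n) (j : Fin n) (lo' : ExtLo) (hi' : ExtHi) :
    Set (Fin n → ℝ) :=
  {x | consSat G x ∧ (∀ j', j' ≠ j → loSat (MILP.lo G j') (x j') ∧ hiSat (MILP.hi G j') (x j'))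
      ∧ loSat lo' (x j) ∧ hiSat hi' (x j)}

/-- Optimal value (in `ℝ ∪ {±∞}`) of the LP `min cᵀx` over `S`:
`+∞` if infeasible, `-∞` if unbounded below. -/
def lpVal {n : ℕ} (c : Fin n → ℝ) (S : Set (Fin n → ℝ)) : EReal :=
  ⨅ x ∈ S, ((∑ j, c j * x j : ℝ) : EReal)

/-- `f*(G)`: optimal value of the LP relaxation of `G`. -/
def fstar {m n : ℕ} (G : MILP m n) : EReal := lpVal (MILP.c G) (lpFeasSet G)

/-- `f*(G, j, lo', hi')`: optimal value of `LP(G, j, lo', hi')`. -/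
def lpValMod {m n : ℕ} (G : MILP m n) (j : Fin n) (lo' : ExtLo) (hi' : ExtHi) : EReal :=
  lpVal (MILP.c G) (feasSetMod G j lo' hi')

/-- The Euclidean norm on `ℝⁿ` (as `Fin n → ℝ`). -/
def euclNorm {n : ℕ} (x : Fin n → ℝ) : ℝ := Real.sqrt (∑ j, x j ^ 2)

/-- The Euclidean distance on `ℝⁿ`. -/
def euclDist {n : ℕ} (x y : Fin n → ℝ) : ℝ := euclNorm (fun j => x j - y j)

/-- `x` is an optimal solution of the LP relaxation of `G`. -/
def IsOptSol {m n : ℕ} (G : MILP m n) (x : Fin n → ℝ) : Prop :=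
  x ∈ lpFeasSet G ∧ ((∑ j, MILP.c G j * x j : ℝ) : EReal) = fstar G

/-- `x` is an optimal solution of smallest Euclidean norm of the LP relaxation of `G`. -/
def IsMinNormOpt {m n : ℕ} (G : MILP m n) (x : Fin n → ℝ) : Prop :=
  IsOptSol G x ∧ ∀ y, IsOptSol G y → euclNorm x ≤ euclNorm y

/-- `x*(G)`: the optimal solution of smallest Euclidean norm of the LP relaxation
(defaults to `0` when it does not exist). -/
def xstar {m n : ℕ} (G : MILP m n) : Fin n → ℝ :=
  if h : ∃ x, IsMinNormOpt G x then h.choose else 0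

/-- `f*(G, j, l_j, ⌊x*(G)_j⌋)`. -/
def branchDown {m n : ℕ} (G : MILP m n) (j : Fin n) : EReal :=
  lpValMod G j (MILP.lo G j) (Sum.inl ((⌊xstar G j⌋ : ℤ) : ℝ))

/-- `f*(G, j, ⌈x*(G)_j⌉, u_j)`. -/
def branchUp {m n : ℕ} (G : MILP m n) (j : Fin n) : EReal :=
  lpValMod G j (Sum.inl ((⌈xstar G j⌉ : ℤ) : ℝ)) (MILP.hi G j)

/-- The strong branching score vector `SB(G) ∈ ℝⁿ`. -/
def SB {m n : ℕ} (G : MILP m n) : Fin n → ℝ := fun j =>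
  if MILP.isInt G j then
    ((branchDown G j).toReal - (fstar G).toReal) * ((branchUp G j).toReal - (fstar G).toReal)
  else 0

/-- `SB(G) ∈ ℝⁿ`: the LP relaxation of `G` is feasible and bounded (so that the
min-norm optimal solution `x*(G)` exists and `f*(G)` is finite), and all the
branch LP values entering the strong branching scores are finite. -/
def SBRealValued {m n : ℕ} (G : MILP m n) : Prop :=
  (∃ x, IsMinNormOpt G x) ∧ fstar G ≠ ⊤ ∧ fstar G ≠ ⊥ ∧
  ∀ j, MILP.isInt G j →
    branchDown G j ≠ ⊤ ∧ branchDown G j ≠ ⊥ ∧ branchUp G j ≠ ⊤ ∧ branchUp G j ≠ ⊥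

/-! ### WL colors -/

abbrev VFeat : Type := ℝ × Sense
abbrev WFeat : Type := ℝ × ExtLo × ExtHi × Bool

/-- The pair (type of constraint-node colors, type of variable-node colors) at
each round of the WL test. -/
def WLTypes : ℕ → Type × Type
  | 0 => (VFeat, WFeat)
  | l + 1 =>
      ((WLTypes l).1 × Multiset ((WLTypes l).2 × ℝ),
       (WLTypes l).2 × Multiset ((WLTypes l).1 × ℝ))

abbrev VColor (l : ℕ) : Type := (WLTypes l).1
abbrev WColor (l : ℕ) : Type := (WLTypes l).2

/-- The canonical WL colors of a MILP instance: `(wl G l).1 i = C_l^V(i)` and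
`(wl G l).2 j = C_l^W(j)`. -/
def wl {m n : ℕ} (G : MILP m n) : (l : ℕ) → (Fin m → VColor l) × (Fin n → WColor l)
  | 0 =>
      (fun i => (MILP.b G i, MILP.sense G i),
       fun j => (MILP.c G j, MILP.lo G j, MILP.hi G j, MILP.isInt G j))
  | l + 1 =>
      (fun i => ((wl G l).1 i,
        (Finset.univ.filter (fun j => MILP.A G i j ≠ 0)).val.map
          (fun j => ((wl G l).2 j, MILP.A G i j))),
       fun j => ((wl G l).2 j,
        (Finset.univ.filter (fun i => MILP.A G i j ≠ 0)).val.map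
          (fun i => ((wl G l).1 i, MILP.A G i j))))

/-- `G` is message-passing-tractable: whenever two constraints and two variables are
respectively indistinguishable by all rounds of the WL test, the corresponding matrix
entries agree (i.e. every submatrix of `A` over a pair of classes of the stable WL
partition is constant). -/
def MPTractable {m n : ℕ} (G : MILP m n) : Prop :=
  ∀ i i' j j', (∀ l, (wl G l).1 i = (wl G l).1 i') → (∀ l, (wl G l).2 j = (wl G l).2 j') →
    MILP.A G i j = MILP.A G i' j'

/-- `G ∼^W G2`. -/
def WLEquivW {m n : ℕ} (G G2 : MILP m n) : Prop :=
  ∀ l, Finset.univ.val.map ((wl G l).1) = Finset.univ.val.map ((wl G2 l).1)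
    ∧ ∀ j, (wl G l).2 j = (wl G2 l).2 j

/-! ### MP-GNNs -/

/-- A message-passing GNN of size `(m,n)`. -/
structure MPGNN (m n : ℕ) where
  L : ℕ
  d : ℕ → ℕ
  e : ℕ → ℕ
  p0 : ℝ × Sense → (Fin (d 0) → ℝ)
  q0 : ℝ × ExtLo × ExtHi × Bool → (Fin (d 0) → ℝ)
  f : (l : ℕ) → (Fin (d l) → ℝ) × ℝ → (Fin (e l) → ℝ)
  g : (l : ℕ) → (Fin (d l) → ℝ) × ℝ → (Fin (e l) → ℝ)
  p : (l : ℕ) → (Fin (d l) → ℝ) × (Fin (e l) → ℝ) → (Fin (d (l + 1)) → ℝ)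
  q : (l : ℕ) → (Fin (d l) → ℝ) × (Fin (e l) → ℝ) → (Fin (d (l + 1)) → ℝ)
  r : (Fin (d L) → ℝ) × (Fin (d L) → ℝ) × (Fin (d L) → ℝ) → ℝ
  p0_cont : Continuous p0
  q0_cont : Continuous q0
  f_cont : ∀ l, Continuous (f l)
  g_cont : ∀ l, Continuous (g l)
  p_cont : ∀ l, Continuous (p l)
  q_cont : ∀ l, Continuous (q l)
  r_cont : Continuous r
  f_zero : ∀ l t, f l (t, 0) = 0
  g_zero : ∀ l s, g l (s, 0) = 0

namespace MPGNN

variable {m n : ℕ}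

/-- The features of an MP-GNN on input `G` after `l` layers:
`(st N G l).1 i = s_i^l` and `(st N G l).2 j = t_j^l`. -/
def st (N : MPGNN m n) (G : MILP m n) :
    (l : ℕ) → (Fin m → (Fin (N.d l) → ℝ)) × (Fin n → (Fin (N.d l) → ℝ))
  | 0 =>
      (fun i => N.p0 (MILP.b G i, MILP.sense G i),
       fun j => N.q0 (MILP.c G j, MILP.lo G j, MILP.hi G j, MILP.isInt G j))
  | l + 1 =>
      (fun i => N.p l ((st N G l).1 i, ∑ j, N.f l ((st N G l).2 j, MILP.A G i j)),
       fun j => N.q l ((st N G l).2 j, ∑ i, N.g l ((st N G l).1 i, MILP.A G i j)))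

/-- The output `F(G) ∈ ℝⁿ` of an MP-GNN. -/
def eval (N : MPGNN m n) (G : MILP m n) : Fin n → ℝ := fun j =>
  N.r (∑ i, (st N G N.L).1 i, ∑ j', (st N G N.L).2 j', (st N G N.L).2 j)

end MPGNN

/-! ### 2-FWL colors -/

/-- The pair (type of `(V,W)`-pair colors, type of `(W,W)`-pair colors) at each
round of the 2-FWL test. -/
def FWLTypes : ℕ → Type × Type
  | 0 => (VFeat × WFeat × ℝ, WFeat × WFeat × Bool)
  | l + 1 =>
      ((FWLTypes l).1 × Multiset ((FWLTypes l).2 × (FWLTypes l).1),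
       (FWLTypes l).2 × Multiset ((FWLTypes l).1 × (FWLTypes l).1))

abbrev VWColor (l : ℕ) : Type := (FWLTypes l).1
abbrev WWColor (l : ℕ) : Type := (FWLTypes l).2

/-- The canonical 2-FWL colors of a MILP instance: `(fwl G l).1 i j = C_l^{VW}(i,j)` and
`(fwl G l).2 j₁ j₂ = C_l^{WW}(j₁,j₂)`. -/
def fwl {m n : ℕ} (G : MILP m n) :
    (l : ℕ) → (Fin m → Fin n → VWColor l) × (Fin n → Fin n → WWColor l)
  | 0 =>
      (fun i j => ((MILP.b G i, MILP.sense G i),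
        (MILP.c G j, MILP.lo G j, MILP.hi G j, MILP.isInt G j), MILP.A G i j),
       fun j1 j2 => ((MILP.c G j1, MILP.lo G j1, MILP.hi G j1, MILP.isInt G j1),
        (MILP.c G j2, MILP.lo G j2, MILP.hi G j2, MILP.isInt G j2), decide (j1 = j2)))
  | l + 1 =>
      (fun i j => ((fwl G l).1 i j,
        Finset.univ.val.map (fun j1 => ((fwl G l).2 j1 j, (fwl G l).1 i j1))),
       fun j1 j2 => ((fwl G l).2 j1 j2,
        Finset.univ.val.map (fun i => ((fwl G l).1 i j2, (fwl G l).1 i j1))))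

/-- `G ∼₂ G2`. -/
def FWLEquiv {m n : ℕ} (G G2 : MILP m n) : Prop :=
  ∀ l, (Finset.univ : Finset (Fin m × Fin n)).val.map (fun p => (fwl G l).1 p.1 p.2)
        = (Finset.univ : Finset (Fin m × Fin n)).val.map (fun p => (fwl G2 l).1 p.1 p.2)
    ∧ (Finset.univ : Finset (Fin n × Fin n)).val.map (fun p => (fwl G l).2 p.1 p.2)
        = (Finset.univ : Finset (Fin n × Fin n)).val.map (fun p => (fwl G2 l).2 p.1 p.2)

/-- `G ∼₂^W G2`. -/
def FWLEquivW {m n : ℕ} (G G2 : MILP m n) : Prop :=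
  ∀ l, ∀ j, Finset.univ.val.map (fun i => (fwl G l).1 i j)
        = Finset.univ.val.map (fun i => (fwl G2 l).1 i j)
    ∧ Finset.univ.val.map (fun j1 => (fwl G l).2 j1 j)
        = Finset.univ.val.map (fun j1 => (fwl G2 l).2 j1 j)

/-! ### 2-FGNNs -/

/-- A second-order folklore GNN of size `(m,n)`. -/
structure FGNN2 (m n : ℕ) where
  L : ℕ
  d : ℕ → ℕ
  e : ℕ → ℕ
  p0 : VFeat × WFeat × ℝ → (Fin (d 0) → ℝ)
  q0 : WFeat × WFeat × Bool → (Fin (d 0) → ℝ)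
  f : (l : ℕ) → (Fin (d l) → ℝ) × (Fin (d l) → ℝ) → (Fin (e l) → ℝ)
  g : (l : ℕ) → (Fin (d l) → ℝ) × (Fin (d l) → ℝ) → (Fin (e l) → ℝ)
  p : (l : ℕ) → (Fin (d l) → ℝ) × (Fin (e l) → ℝ) → (Fin (d (l + 1)) → ℝ)
  q : (l : ℕ) → (Fin (d l) → ℝ) × (Fin (e l) → ℝ) → (Fin (d (l + 1)) → ℝ)
  r : (Fin (d L) → ℝ) × (Fin (d L) → ℝ) → ℝ
  p0_cont : Continuous p0
  q0_cont : Continuous q0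
  f_cont : ∀ l, Continuous (f l)
  g_cont : ∀ l, Continuous (g l)
  p_cont : ∀ l, Continuous (p l)
  q_cont : ∀ l, Continuous (q l)
  r_cont : Continuous r

namespace FGNN2

variable {m n : ℕ}

/-- The features of a 2-FGNN on input `G` after `l` layers:
`(st N G l).1 i j = s_{ij}^l` and `(st N G l).2 j₁ j₂ = t_{j₁j₂}^l`. -/
def st (N : FGNN2 m n) (G : MILP m n) :
    (l : ℕ) → (Fin m → Fin n → (Fin (N.d l) → ℝ)) × (Fin n → Fin n → (Fin (N.d l) → ℝ))
  | 0 =>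
      (fun i j => N.p0 ((MILP.b G i, MILP.sense G i),
        (MILP.c G j, MILP.lo G j, MILP.hi G j, MILP.isInt G j), MILP.A G i j),
       fun j1 j2 => N.q0 ((MILP.c G j1, MILP.lo G j1, MILP.hi G j1, MILP.isInt G j1),
        (MILP.c G j2, MILP.lo G j2, MILP.hi G j2, MILP.isInt G j2), decide (j1 = j2)))
  | l + 1 =>
      (fun i j => N.p l ((st N G l).1 i j, ∑ j1, N.f l ((st N G l).2 j1 j, (st N G l).1 i j1)),
       fun j1 j2 => N.q l ((st N G l).2 j1 j2, ∑ i, N.g l ((st N G l).1 i j2, (st N G l).1 i j1)))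

/-- The output `F(G) ∈ ℝⁿ` of a 2-FGNN. -/
def eval (N : FGNN2 m n) (G : MILP m n) : Fin n → ℝ := fun j =>
  N.r (∑ i, (st N G N.L).1 i j, ∑ j1, (st N G N.L).2 j1 j)

end FGNN2


/-- The number of monomials in `k` variables with all partial degrees less than `N` is `N ^ k`;
`monomials N x` lists their values at `x`. -/
def monomials (N : ℕ) {k : ℕ} (x : Fin k → ℝ) : Fin (N ^ k) → ℝ :=
  fun e => ∏ i, x i ^ (finFunctionFinEquiv.symm e i : ℕ)

lemma continuous_monomials (N k : ℕ) :
    Continuous (monomials N : (Fin k → ℝ) → Fin (N ^ k) → ℝ) := by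
  unfold monomials
  fun_prop

/-- On a finite set with at most `N` points, the indicator of a point is a linear combination of
monomials with partial degrees less than `N`. -/
lemma exists_monomials_eq_indicator {N k : ℕ} (X : Finset (Fin k → ℝ)) (hX : X.card ≤ N)
    (x₀ : Fin k → ℝ) (hx₀ : x₀ ∈ X) :
    ∃ a : Fin (N ^ k) → ℝ, ∀ x ∈ X, ∑ e, a e * monomials N x e = if x = x₀ then 1 else 0 := by
  have key : ∀ i : Fin k, ∃ P : Polynomial ℝ, P.natDegree < N ∧ P.eval (x₀ i) = 1 ∧
      ∀ x ∈ X, x i ≠ x₀ i → P.eval (x i) = 0 := by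
    intro i
    set Y := (X.image (fun x => x i)).erase (x₀ i) with hY
    have hYc : Y.card < N := by
      have h1 : x₀ i ∈ X.image (fun x => x i) := Finset.mem_image_of_mem _ hx₀
      have h2 := Finset.card_erase_lt_of_mem h1
      exact lt_of_lt_of_le h2 (Finset.card_image_le.trans hX)
    refine ⟨∏ v ∈ Y, (Polynomial.C (x₀ i - v)⁻¹ * (Polynomial.X - Polynomial.C v)), ?_, ?_, ?_⟩
    · refine lt_of_le_of_lt (Polynomial.natDegree_prod_le _ _) ?_
      refine lt_of_le_of_lt (Finset.sum_le_sum (g := fun _ => 1) fun v _ => ?_) (by simpa using hYc)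
      refine (Polynomial.natDegree_C_mul_le _ _).trans ?_
      simp
    · rw [Polynomial.eval_prod]
      refine Finset.prod_eq_one fun v hv => ?_
      have : x₀ i - v ≠ 0 := sub_ne_zero.mpr (Finset.ne_of_mem_erase hv).symm
      simp [this]
    · intro x hx hne
      rw [Polynomial.eval_prod]
      refine Finset.prod_eq_zero (i := x i) ?_ (by simp)
      exact Finset.mem_erase.mpr ⟨hne, Finset.mem_image_of_mem _ hx⟩
  choose P hdeg hone hzero using key
  refine ⟨fun e => ∏ i, (P i).coeff (finFunctionFinEquiv.symm e i : ℕ), fun x hx => ?_⟩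
  have hexp : ∏ i, (P i).eval (x i) = ∑ e : Fin (N ^ k),
      (∏ i, (P i).coeff (finFunctionFinEquiv.symm e i : ℕ)) * monomials N x e := by
    have h1 : ∀ i, (P i).eval (x i) = ∑ d : Fin N, (P i).coeff d * x i ^ (d : ℕ) := fun i => by
      rw [Polynomial.eval_eq_sum_range' (hdeg i), Finset.sum_range]
    simp_rw [h1]
    rw [Finset.prod_univ_sum, Fintype.piFinset_univ]
    rw [← Equiv.sum_comp (finFunctionFinEquiv (m := N) (n := k)).symm]
    simp only [monomials, Finset.prod_mul_distrib]
  rw [← hexp]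
  split_ifs with h
  · subst h
    exact Finset.prod_eq_one fun i _ => hone i
  · obtain ⟨i, hi⟩ := Function.ne_iff.mp h
    exact Finset.prod_eq_zero (Finset.mem_univ i) (hzero i x hx hi)

/-- Weighted sums of monomials determine a finitely supported measure. -/
lemma sum_ite_eq_of_sum_monomials_eq {ι : Type*} [Fintype ι] {N k : ℕ}
    (hN : 2 * Fintype.card ι ≤ N) (w w' : ι → ℝ) (x x' : ι → Fin k → ℝ)
    (h : ∑ j, w j • monomials N (x j) = ∑ j, w' j • monomials N (x' j)) (x₀ : Fin k → ℝ) :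
    ∑ j, (if x j = x₀ then w j else 0) = ∑ j, (if x' j = x₀ then w' j else 0) := by
  set X := Finset.univ.image x ∪ Finset.univ.image x' with hXdef
  have hX : X.card ≤ N := by
    refine (Finset.card_union_le _ _).trans (le_trans ?_ hN)
    have h1 : (Finset.univ.image x).card ≤ Fintype.card ι := Finset.card_image_le
    have h2 : (Finset.univ.image x').card ≤ Fintype.card ι := Finset.card_image_le
    omega
  have hx : ∀ j, x j ∈ X := fun j =>
    Finset.mem_union_left _ (Finset.mem_image_of_mem _ (Finset.mem_univ j))
  have hx' : ∀ j, x' j ∈ X := fun j =>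
    Finset.mem_union_right _ (Finset.mem_image_of_mem _ (Finset.mem_univ j))
  by_cases hmem : x₀ ∈ X
  · obtain ⟨a, ha⟩ := exists_monomials_eq_indicator X hX x₀ hmem
    have expand : ∀ (v : ι → ℝ) (y : ι → Fin k → ℝ), (∀ j, y j ∈ X) →
        ∑ j, (if y j = x₀ then v j else 0) = ∑ e, a e * (∑ j, v j • monomials N (y j)) e := by
      intro v y hy
      simp only [Finset.sum_apply, Pi.smul_apply, smul_eq_mul, Finset.mul_sum]
      rw [Finset.sum_comm]
      refine Finset.sum_congr rfl fun j _ => ?_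
      have h1 : ∀ e, a e * (v j * monomials N (y j) e) = v j * (a e * monomials N (y j) e) :=
        fun e => by ring
      simp only [h1]
      rw [← Finset.mul_sum, ha _ (hy j)]
      simp
  
    rw [expand w x hx, expand w' x' hx', h]
  · have h1 : ∀ j, x j ≠ x₀ := fun j hj => hmem (hj ▸ hx j)
    have h2 : ∀ j, x' j ≠ x₀ := fun j hj => hmem (hj ▸ hx' j)
    simp [h1, h2]

/-- The multiset of colors of neighbours, together with the nonzero edge weights. -/
def neighbors {ι γ : Type*} [Fintype ι] (c : ι → γ) (a : ι → ℝ) : Multiset (γ × ℝ) :=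
  (Finset.univ.filter (fun j => a j ≠ 0)).val.map (fun j => (c j, a j))

lemma Multiset.map_eq_map_of_imp {α β γ δ : Type*} {s : Multiset α} {t : Multiset β}
    {f : α → γ} {g : β → γ} {f' : α → δ} {g' : β → δ} (h : s.map f = t.map g)
    (himp : ∀ a b, f a = g b → f' a = g' b) : s.map f' = t.map g' := by
  rw [← Multiset.rel_eq, Multiset.rel_map] at h ⊢
  exact h.mono fun a _ b _ hab => himp a b hab

lemma neighbors_eq_of_imp {ι γ δ : Type*} [Fintype ι] {c c' : ι → γ} {d d' : ι → δ}
    {a a' : ι → ℝ} (h : neighbors c a = neighbors c' a')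
    (himp : ∀ j j', c j = c' j' → d j = d' j') : neighbors d a = neighbors d' a' := by
  refine Multiset.map_eq_map_of_imp h fun j j' hj => ?_
  rw [Prod.mk.injEq] at hj ⊢
  exact ⟨himp _ _ hj.1, hj.2⟩

lemma neighbors_eq_of_sum_monomials_eq {ι : Type*} [Fintype ι] {N k : ℕ}
    (hN : 2 * Fintype.card ι ≤ N) (c c' : ι → Fin k → ℝ) (a a' : ι → ℝ)
    (h : ∑ j, a j • monomials N (Fin.snoc (α := fun _ => ℝ) (c j) (a j)) =
      ∑ j, a' j • monomials N (Fin.snoc (α := fun _ => ℝ) (c' j) (a' j))) :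
    neighbors c a = neighbors c' a' := by
  ext ⟨y, v⟩
  have key := sum_ite_eq_of_sum_monomials_eq hN _ _ _ _ h (Fin.snoc (α := fun _ => ℝ) y v)
  have count_mul : ∀ (c : ι → Fin k → ℝ) (a : ι → ℝ),
      ∑ j, (if Fin.snoc (α := fun _ => ℝ) (c j) (a j) =
        Fin.snoc (α := fun _ => ℝ) y v then a j else 0) =
        v * (Multiset.count (y, v) (neighbors c a) : ℝ) := by
    intro c a
    simp only [Fin.snoc_inj]
    by_cases hv : v = 0
    · subst hv
      rw [zero_mul]
      refine Finset.sum_eq_zero fun j _ => ?_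
      split_ifs with hj
      · exact hj.2
      · rfl
    · rw [neighbors, Multiset.count_map, ← Finset.filter_val, Finset.card_val,
        Finset.filter_filter, mul_comm, ← nsmul_eq_mul, ← Finset.sum_const,
        Finset.sum_filter]
      refine Finset.sum_congr rfl fun j _ => ?_
      by_cases hj : c j = y ∧ a j = v
      · have : a j ≠ 0 ∧ (y, v) = (c j, a j) := ⟨hj.2 ▸ hv, by rw [hj.1, hj.2]⟩
        rw [if_pos hj, if_pos this, hj.2]
      · have : ¬ (a j ≠ 0 ∧ (y, v) = (c j, a j)) := fun h => hj (by
          have := Prod.mk.inj h.2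
          exact ⟨this.1.symm, this.2.symm⟩)
        rw [if_neg hj, if_neg this]
  rw [count_mul, count_mul] at key
  by_cases hv : v = 0
  · subst hv
    have hz : ∀ (c : ι → Fin k → ℝ) (a : ι → ℝ), Multiset.count (y, 0) (neighbors c a) = 0 := by
      intro c a
      rw [Multiset.count_eq_zero]
      simp +contextual [neighbors]
    rw [hz, hz]
  · exact_mod_cast mul_left_cancel₀ hv key

lemma map_univ_eq_of_sum_monomials_eq {ι : Type*} [Fintype ι] {N k : ℕ}
    (hN : 2 * Fintype.card ι ≤ N) (c c' : ι → Fin k → ℝ)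
    (h : ∑ j, monomials N (c j) = ∑ j, monomials N (c' j)) :
    (Finset.univ.val.map c) = Finset.univ.val.map c' := by
  ext y
  have key := sum_ite_eq_of_sum_monomials_eq hN (fun _ => 1) (fun _ => 1) c c' (by simpa using h) y
  simp only [Finset.sum_boole] at key
  rw [Multiset.count_map, Multiset.count_map, ← Finset.filter_val, ← Finset.filter_val,
    Finset.card_val, Finset.card_val]
  simp only [eq_comm (a := y)]
  exact_mod_cast key

/-- A real encoding of extended bounds: finite bounds `a` become `(a, 1)`, and infinite bounds
become `(0, 0)`. -/
def boundEnc : ℝ ⊕ Unit → ℝ × ℝ := Sum.elim (fun a => (a, 1)) (fun _ => (0, 0))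

lemma continuous_boundEnc : Continuous boundEnc := by
  unfold boundEnc
  fun_prop

lemma boundEnc_injective : Function.Injective boundEnc := by
  rintro (a | a) (b | b) h <;> simp_all [boundEnc]

lemma loSat_iff (l : ExtLo) (x : ℝ) : loSat l x ↔ (boundEnc l).1 ≤ (boundEnc l).2 * x := by
  rcases l with a | a <;> simp [loSat, boundEnc]

lemma hiSat_iff (u : ExtHi) (x : ℝ) : hiSat u x ↔ (boundEnc u).2 * x ≤ (boundEnc u).1 := by
  rcases u with a | a <;> simp [hiSat, boundEnc]

/-- Dimensions of the features of the moment network. -/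
def featDim (N : ℕ) : ℕ → ℕ
  | 0 => 6
  | l + 1 => featDim N l + N ^ (featDim N l + 1) + N ^ featDim N l

/-- Initial features of a constraint node. -/
def initV (v : ℝ × Sense) : Fin 6 → ℝ := ![v.1, (v.2 : ℕ), 0, 0, 0, 0]

/-- Initial features of a variable node. -/
def initW (w : ℝ × ExtLo × ExtHi × Bool) : Fin 6 → ℝ :=
  ![w.1, (boundEnc w.2.1).1, (boundEnc w.2.1).2, (boundEnc w.2.2.1).1, (boundEnc w.2.2.1).2,
    if w.2.2.2 then 1 else 0]

/-- Messages of the moment network: weighted monomials of the features and the edge weight. -/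
def message (N : ℕ) {k : ℕ} (x : (Fin k → ℝ) × ℝ) : Fin (N ^ (k + 1)) → ℝ :=
  x.2 • monomials N (Fin.snoc (α := fun _ => ℝ) x.1 x.2)

/-- Updates of the moment network: keep the old features, the aggregated messages and the monomials
of the old features. -/
def nodeUpdate (N : ℕ) {k e : ℕ} (x : (Fin k → ℝ) × (Fin e → ℝ)) : Fin (k + e + N ^ k) → ℝ :=
  Fin.append (Fin.append x.1 x.2) (monomials N x.1)

lemma continuous_initV : Continuous initV := by
  have h : Continuous fun v : ℝ × Sense => ((v.2 : ℕ) : ℝ) :=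
    (continuous_of_discreteTopology (f := fun s : Sense => ((s : ℕ) : ℝ))).comp continuous_snd
  refine continuous_pi fun i => ?_
  fin_cases i <;> simp [initV] <;> fun_prop

lemma continuous_initW : Continuous initW := by
  have h : Continuous fun w : ℝ × ExtLo × ExtHi × Bool => if w.2.2.2 then (1 : ℝ) else 0 :=
    (continuous_of_discreteTopology (f := fun s : Bool => if s then (1 : ℝ) else 0)).comp
      (by fun_prop : Continuous fun w : ℝ × ExtLo × ExtHi × Bool => w.2.2.2)
  have h' := continuous_boundEnc
  refine continuous_pi fun i => ?_
  fin_cases i <;> simp [initW] <;> fun_prop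

lemma initV_injective : Function.Injective initV := by
  rintro ⟨a, s⟩ ⟨b, t⟩ h
  have h0 := congrFun h 0
  have h1 := congrFun h 1
  simp only [initV, Matrix.cons_val_zero, Matrix.cons_val_one] at h0 h1
  rw [h0, Fin.ext (Nat.cast_injective h1)]

lemma initW_injective : Function.Injective initW := by
  rintro ⟨a, l, u, i⟩ ⟨b, l', u', i'⟩ h
  have h0 : a = b := congrFun h 0
  have hl : boundEnc l = boundEnc l' := Prod.ext (congrFun h 1) (congrFun h 2)
  have hu : boundEnc u = boundEnc u' := Prod.ext (congrFun h 3) (congrFun h 4)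
  have hi : (if i then (1 : ℝ) else 0) = if i' then 1 else 0 := congrFun h 5
  rw [h0, boundEnc_injective hl, boundEnc_injective hu]
  cases i <;> cases i' <;> simp_all

lemma continuous_message (N k : ℕ) :
    Continuous (message N : (Fin k → ℝ) × ℝ → Fin (N ^ (k + 1)) → ℝ) := by
  unfold message
  have h := continuous_monomials N (k + 1)
  have h2 : Continuous fun x : (Fin k → ℝ) × ℝ =>
      (Fin.snoc (α := fun _ => ℝ) x.1 x.2 : Fin (k + 1) → ℝ) :=
    Continuous.finSnoc (A := fun _ => ℝ) continuous_fst continuous_snd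
  exact continuous_snd.smul (h.comp h2)

lemma continuous_nodeUpdate (N k e : ℕ) :
    Continuous (nodeUpdate N : (Fin k → ℝ) × (Fin e → ℝ) → Fin (k + e + N ^ k) → ℝ) := by
  have h := continuous_monomials N k
  refine continuous_pi fun i => ?_
  simp only [nodeUpdate]
  refine Fin.addCases (fun i => ?_) (fun i => ?_) i
  · simp only [Fin.append_left]
    refine Fin.addCases (fun i => ?_) (fun i => ?_) i
    · simp only [Fin.append_left]
      fun_prop
    · simp only [Fin.append_right]
      fun_prop
  · simp only [Fin.append_right]
    fun_prop

lemma nodeUpdate_eq_iff {N k e : ℕ} {x y : (Fin k → ℝ) × (Fin e → ℝ)} :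
    nodeUpdate N x = nodeUpdate N y ↔ x = y := by
  refine ⟨fun h => ?_, fun h => h ▸ rfl⟩
  refine Prod.ext (funext fun i => ?_) (funext fun i => ?_)
  · simpa [nodeUpdate] using congrFun h (Fin.castAdd _ (Fin.castAdd _ i))
  · simpa [nodeUpdate] using congrFun h (Fin.castAdd _ (Fin.natAdd _ i))

lemma sum_monomials_eq_of_sum_nodeUpdate_eq {ι : Type*} [Fintype ι] {N k e : ℕ}
    {x y : ι → (Fin k → ℝ) × (Fin e → ℝ)}
    (h : ∑ j, nodeUpdate N (x j) = ∑ j, nodeUpdate N (y j)) :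
    ∑ j, monomials N (x j).1 = ∑ j, monomials N (y j).1 := by
  ext i
  have := congrFun h (Fin.natAdd _ i)
  simpa [nodeUpdate, Finset.sum_apply] using this

/-- The moment network with read-out `r`. -/
def momentNet (m n N L : ℕ)
    (r : (Fin (featDim N L) → ℝ) × (Fin (featDim N L) → ℝ) × (Fin (featDim N L) → ℝ) → ℝ)
    (hr : Continuous r) : MPGNN m n where
  L := L
  d := featDim N
  e := fun l => N ^ (featDim N l + 1)
  p0 := initV
  q0 := initW
  f := fun _ => message N
  g := fun _ => message N
  p := fun _ => nodeUpdate N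
  q := fun _ => nodeUpdate N
  r := r
  p0_cont := continuous_initV
  q0_cont := continuous_initW
  f_cont := fun _ => continuous_message _ _
  g_cont := fun _ => continuous_message _ _
  p_cont := fun _ => continuous_nodeUpdate _ _ _
  q_cont := fun _ => continuous_nodeUpdate _ _ _
  r_cont := hr
  f_zero := fun l t => by simp [message]
  g_zero := fun l t => by simp [message]

/-- The features computed by the moment network. -/
def feat {m n : ℕ} (N : ℕ) (G : MILP m n) :
    (l : ℕ) → (Fin m → (Fin (featDim N l) → ℝ)) × (Fin n → (Fin (featDim N l) → ℝ))
  | 0 =>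
      (fun i => initV (MILP.b G i, MILP.sense G i),
       fun j => initW (MILP.c G j, MILP.lo G j, MILP.hi G j, MILP.isInt G j))
  | l + 1 =>
      (fun i => nodeUpdate N ((feat N G l).1 i, ∑ j, message N ((feat N G l).2 j, MILP.A G i j)),
       fun j => nodeUpdate N ((feat N G l).2 j, ∑ i, message N ((feat N G l).1 i, MILP.A G i j)))

lemma momentNet_st {m n N L : ℕ} {r} {hr : Continuous r} (G : MILP m n) (l : ℕ) :
    (momentNet m n N L r hr).st G l = feat N G l := by
  induction l with
  | zero => rfl
  | succ l ih =>
    simp only [MPGNN.st, feat, ih]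
    rfl

/-- The read-out input of the moment network at variable `j`. -/
def readout {m n : ℕ} (N L : ℕ) (G : MILP m n) (j : Fin n) :
    (Fin (featDim N L) → ℝ) × (Fin (featDim N L) → ℝ) × (Fin (featDim N L) → ℝ) :=
  (∑ i, (feat N G L).1 i, ∑ j', (feat N G L).2 j', (feat N G L).2 j)

lemma momentNet_eval {m n N L : ℕ} {r} {hr : Continuous r} (G : MILP m n) (j : Fin n) :
    (momentNet m n N L r hr).eval G j = r (readout N L G j) := by
  have h := momentNet_st (N := N) (L := L) (hr := hr) G L
  change r (∑ i, ((momentNet m n N L r hr).st G L).1 i,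
    ∑ j', ((momentNet m n N L r hr).st G L).2 j', ((momentNet m n N L r hr).st G L).2 j) = _
  rw [h]
  rfl

lemma continuous_feat {m n : ℕ} (N l : ℕ) :
    (∀ i, Continuous fun G : MILP m n => (feat N G l).1 i) ∧
      ∀ j, Continuous fun G : MILP m n => (feat N G l).2 j := by
  induction l with
  | zero =>
    refine ⟨fun i => continuous_initV.comp ?_, fun j => continuous_initW.comp ?_⟩
    · unfold MILP.b MILP.sense
      fun_prop
    · unfold MILP.c MILP.lo MILP.hi MILP.isInt
      fun_prop
  | succ l ih =>
    have hA : ∀ i j, Continuous fun G : MILP m n => MILP.A G i j := fun i j => by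
      unfold MILP.A
      fun_prop
    have hv := ih.1
    have hw := ih.2
    refine ⟨fun i => (continuous_nodeUpdate N _ _).comp ((hv i).prodMk
      (continuous_finsetSum _ fun j _ => (continuous_message N _).comp ((hw j).prodMk (hA i j)))),
      fun j => (continuous_nodeUpdate N _ _).comp ((hw j).prodMk
      (continuous_finsetSum _ fun i _ => (continuous_message N _).comp ((hv i).prodMk (hA i j))))⟩

lemma continuous_readout {m n : ℕ} (N L : ℕ) (j : Fin n) :
    Continuous fun G : MILP m n => readout N L G j := by
  have h := continuous_feat (m := m) (n := n) N L
  exact (continuous_finsetSum _ fun i _ => h.1 i).prodMk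
    ((continuous_finsetSum _ fun j _ => h.2 j).prodMk (h.2 j))

lemma sum_message_eq {ι : Type*} [Fintype ι] {N k : ℕ} (c : ι → Fin k → ℝ) (a : ι → ℝ) :
    ∑ j, message N (c j, a j) = ((neighbors c a).map (message N)).sum := by
  rw [neighbors, Multiset.map_map]
  change _ = ∑ j ∈ Finset.univ.filter (fun j => a j ≠ 0), message N (c j, a j)
  rw [Finset.sum_filter]
  refine Finset.sum_congr rfl fun j _ => ?_
  split_ifs with h
  · rfl
  · simp [message, not_not.mp h]

lemma sum_message_eq_iff {ι : Type*} [Fintype ι] {N k : ℕ} (hN : 2 * Fintype.card ι ≤ N)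
    {c c' : ι → Fin k → ℝ} {a a' : ι → ℝ} :
    ∑ j, message N (c j, a j) = ∑ j, message N (c' j, a' j) ↔ neighbors c a = neighbors c' a' :=
  ⟨neighbors_eq_of_sum_monomials_eq hN c c' a a', fun h => by
    rw [sum_message_eq, sum_message_eq, h]⟩

lemma wl_succ_fst_eq_iff {m n : ℕ} {G G' : MILP m n} {l : ℕ} {i i' : Fin m} :
    (wl G (l + 1)).1 i = (wl G' (l + 1)).1 i' ↔ (wl G l).1 i = (wl G' l).1 i' ∧
      neighbors (wl G l).2 (MILP.A G i) = neighbors (wl G' l).2 (MILP.A G' i') :=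
  Prod.mk_inj

lemma wl_succ_snd_eq_iff {m n : ℕ} {G G' : MILP m n} {l : ℕ} {j j' : Fin n} :
    (wl G (l + 1)).2 j = (wl G' (l + 1)).2 j' ↔ (wl G l).2 j = (wl G' l).2 j' ∧
      neighbors (wl G l).1 (fun i => MILP.A G i j) =
        neighbors (wl G' l).1 (fun i => MILP.A G' i j') :=
  Prod.mk_inj

/-- The features of the moment network are equivalent to the WL colors. -/
lemma feat_eq_iff {m n N : ℕ} (hN : 2 * (m + n) ≤ N) (G G' : MILP m n) (l : ℕ) :
    (∀ i i', (feat N G l).1 i = (feat N G' l).1 i' ↔ (wl G l).1 i = (wl G' l).1 i') ∧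
      ∀ j j', (feat N G l).2 j = (feat N G' l).2 j' ↔ (wl G l).2 j = (wl G' l).2 j' := by
  have hm : 2 * Fintype.card (Fin m) ≤ N := by simp; omega
  have hn : 2 * Fintype.card (Fin n) ≤ N := by simp; omega
  induction l with
  | zero => exact ⟨fun i i' => initV_injective.eq_iff, fun j j' => initW_injective.eq_iff⟩
  | succ l ih =>
    refine ⟨fun i i' => ?_, fun j j' => ?_⟩
    · rw [wl_succ_fst_eq_iff, ← ih.1]
      refine nodeUpdate_eq_iff.trans (Prod.mk_inj.trans (and_congr_right fun _ => ?_))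
      rw [sum_message_eq_iff hn]
      exact ⟨fun h => neighbors_eq_of_imp h fun a b => (ih.2 a b).1,
        fun h => neighbors_eq_of_imp h fun a b => (ih.2 a b).2⟩
    · rw [wl_succ_snd_eq_iff, ← ih.2]
      refine nodeUpdate_eq_iff.trans (Prod.mk_inj.trans (and_congr_right fun _ => ?_))
      rw [sum_message_eq_iff hm]
      exact ⟨fun h => neighbors_eq_of_imp h fun a b => (ih.1 a b).1,
        fun h => neighbors_eq_of_imp h fun a b => (ih.1 a b).2⟩

/-- Equal read-out inputs come from WL-indistinguishable instances. -/
lemma wl_eq_of_readout_eq {m n N L : ℕ} (hN : 2 * (m + n) ≤ N) {G G' : MILP m n} {j j' : Fin n}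
    (h : readout N (L + 1) G j = readout N (L + 1) G' j') :
    Finset.univ.val.map (wl G L).1 = Finset.univ.val.map (wl G' L).1 ∧
      Finset.univ.val.map (wl G L).2 = Finset.univ.val.map (wl G' L).2 ∧
      (wl G L).2 j = (wl G' L).2 j' := by
  have hm : 2 * Fintype.card (Fin m) ≤ N := by simp; omega
  have hn : 2 * Fintype.card (Fin n) ≤ N := by simp; omega
  simp only [readout, Prod.mk.injEq] at h
  refine ⟨?_, ?_, ?_⟩
  · exact Multiset.map_eq_map_of_imp
      (map_univ_eq_of_sum_monomials_eq hm _ _ (sum_monomials_eq_of_sum_nodeUpdate_eq h.1))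
      fun a b => ((feat_eq_iff hN G G' L).1 a b).1
  · exact Multiset.map_eq_map_of_imp
      (map_univ_eq_of_sum_monomials_eq hn _ _ (sum_monomials_eq_of_sum_nodeUpdate_eq h.2.1))
      fun a b => ((feat_eq_iff hN G G' L).2 a b).1
  · exact (wl_succ_snd_eq_iff.1 (((feat_eq_iff hN G G' (L + 1)).2 j j').1 h.2.2)).1

/-- Two constraints, or two variables, of a family of instances have the same WL color at
round `l`. -/
def wlAgree {m n : ℕ} (H : Bool → MILP m n) (l : ℕ) :
    ((Bool × Fin m) × (Bool × Fin m)) ⊕ ((Bool × Fin n) × (Bool × Fin n)) → Prop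
  | Sum.inl (x, y) => (wl (H x.1) l).1 x.2 = (wl (H y.1) l).1 y.2
  | Sum.inr (x, y) => (wl (H x.1) l).2 x.2 = (wl (H y.1) l).2 y.2

lemma wlAgree_of_succ {m n : ℕ} {H : Bool → MILP m n} {l : ℕ} {p} (h : wlAgree H (l + 1) p) :
    wlAgree H l p := by
  rcases p with ⟨x, y⟩ | ⟨x, y⟩
  · exact (wl_succ_fst_eq_iff.1 h).1
  · exact (wl_succ_snd_eq_iff.1 h).1

lemma wlAgree_stable {m n : ℕ} {H : Bool → MILP m n} {l : ℕ}
    (h : ∀ p, wlAgree H l p → wlAgree H (l + 1) p) (p) (hp : wlAgree H (l + 1) p) :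
    wlAgree H (l + 2) p := by
  rcases p with ⟨x, y⟩ | ⟨x, y⟩
  · refine wl_succ_fst_eq_iff.2 ⟨hp, neighbors_eq_of_imp (wl_succ_fst_eq_iff.1 hp).2 ?_⟩
    exact fun j j' hj => h (Sum.inr ((x.1, j), (y.1, j'))) hj
  · refine wl_succ_snd_eq_iff.2 ⟨hp, neighbors_eq_of_imp (wl_succ_snd_eq_iff.1 hp).2 ?_⟩
    exact fun j k hjk => h (Sum.inl ((x.1, j), (y.1, k))) hjk

/-- A number of rounds after which the WL test on a pair of instances is stable. -/
def wlRounds (m n : ℕ) : ℕ :=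
  Fintype.card (((Bool × Fin m) × (Bool × Fin m)) ⊕ ((Bool × Fin n) × (Bool × Fin n)))

lemma wlAgree_all {m n : ℕ} {H : Bool → MILP m n} {p} (h : wlAgree H (wlRounds m n) p) (l : ℕ) :
    wlAgree H l p := by
  set D : ℕ → Finset (((Bool × Fin m) × (Bool × Fin m)) ⊕ ((Bool × Fin n) × (Bool × Fin n))) :=
    fun l => Finset.univ.filter (fun p => ¬ wlAgree H l p) with hD
  have hmem : ∀ l p, p ∈ D l ↔ ¬ wlAgree H l p := fun l p => by simp [hD]
  have hmono : Monotone D := monotone_nat_of_le_succ fun l p hp =>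
    (hmem _ _).2 fun h' => (hmem _ _).1 hp (wlAgree_of_succ h')
  have hstab : ∀ l, (D l).card = (D (l + 1)).card → (D (l + 1)).card = (D (l + 2)).card := by
    intro l hl
    have heq : D l = D (l + 1) := Finset.eq_of_subset_of_card_le (hmono (Nat.le_succ l)) hl.ge
    have himp : ∀ p, wlAgree H l p → wlAgree H (l + 1) p := fun p hp => by
      by_contra hcon
      exact (hmem l p).1 (heq ▸ (hmem (l + 1) p).2 hcon) hp
    congr 1
    ext p
    rw [hmem, hmem, not_iff_not]
    exact ⟨wlAgree_stable himp p, wlAgree_of_succ⟩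
  by_cases hl : l ≤ wlRounds m n
  · by_contra hcon
    exact (hmem _ _).1 (hmono hl ((hmem l p).2 hcon)) h
  · have hl' : wlRounds m n ≤ l := (not_le.1 hl).le
    have hcard : (D l).card = (D (wlRounds m n)).card :=
      Nat.stabilises_of_monotone (fun a b hab => Finset.card_le_card (hmono hab))
        (fun l => Finset.card_le_univ (D l)) hstab hl'
    have heq : D (wlRounds m n) = D l := Finset.eq_of_subset_of_card_le (hmono hl') hcard.le
    by_contra hcon
    exact (hmem _ p).1 (heq ▸ (hmem l p).2 hcon) h

lemma exists_perm_of_map_univ_eq {ι γ : Type*} [Fintype ι] {c c' : ι → γ}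
    (h : Finset.univ.val.map c = Finset.univ.val.map c') :
    ∃ σ : Equiv.Perm ι, ∀ i, c i = c' (σ i) := by
  have hcard : ∀ y, Fintype.card {i // c i = y} = Fintype.card {i // c' i = y} := by
    intro y
    have h1 := congrArg (Multiset.count y) h
    rw [Multiset.count_map, Multiset.count_map, ← Finset.filter_val, ← Finset.filter_val,
      Finset.card_val, Finset.card_val] at h1
    rw [Fintype.card_subtype, Fintype.card_subtype]
    simpa only [eq_comm (a := y)] using h1
  have e : ∀ y, {i // c i = y} ≃ {i // c' i = y} := fun y => Fintype.equivOfCardEq (hcard y)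
  refine ⟨((Equiv.sigmaFiberEquiv c).symm.trans (Equiv.sigmaCongrRight e)).trans
    (Equiv.sigmaFiberEquiv c'), fun i => ?_⟩
  exact ((e (c i)) ⟨i, rfl⟩).2.symm

/-- The permutations `σ` and `τ` form an isomorphism of MILP instances. -/
structure IsMILPIso {m n : ℕ} (G G' : MILP m n) (σ : Equiv.Perm (Fin m))
    (τ : Equiv.Perm (Fin n)) : Prop where
  A_eq : ∀ i j, MILP.A G i j = MILP.A G' (σ i) (τ j)
  b_eq : ∀ i, MILP.b G i = MILP.b G' (σ i)
  sense_eq : ∀ i, MILP.sense G i = MILP.sense G' (σ i)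
  c_eq : ∀ j, MILP.c G j = MILP.c G' (τ j)
  lo_eq : ∀ j, MILP.lo G j = MILP.lo G' (τ j)
  hi_eq : ∀ j, MILP.hi G j = MILP.hi G' (τ j)
  isInt_eq : ∀ j, MILP.isInt G j = MILP.isInt G' (τ j)

lemma A_eq_of_wl_eq {m n : ℕ} {G G' : MILP m n} (hG' : MPTractable G') {T : ℕ} {i i' : Fin m}
    {j j' : Fin n} (hstab : ∀ j j', (wl G' T).2 j = (wl G' T).2 j' →
      ∀ l, (wl G' l).2 j = (wl G' l).2 j')
    (hi : (wl G (T + 1)).1 i = (wl G' (T + 1)).1 i')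
    (hj : (wl G T).2 j = (wl G' T).2 j') (hA : MILP.A G i j ≠ 0) :
    MILP.A G i j = MILP.A G' i' j' := by
  have hnb := (wl_succ_fst_eq_iff.1 hi).2
  have hmem : ((wl G T).2 j, MILP.A G i j) ∈ neighbors (wl G T).2 (MILP.A G i) :=
    Multiset.mem_map.2 ⟨j, by simpa using hA, rfl⟩
  rw [hnb] at hmem
  obtain ⟨k, -, hk⟩ := Multiset.mem_map.1 hmem
  obtain ⟨hk1, hk2⟩ := Prod.mk.inj hk
  rw [← hk2]
  exact hG' _ _ _ _ (fun _ => rfl) (hstab _ _ (hk1.trans hj))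

/-- Two MP-tractable instances that the WL test does not distinguish are isomorphic. -/
lemma exists_iso_of_wl_eq {m n : ℕ} {G G' : MILP m n} (hG : MPTractable G) (hG' : MPTractable G')
    {j j' : Fin n}
    (hV : Finset.univ.val.map (wl G (wlRounds m n)).1 =
      Finset.univ.val.map (wl G' (wlRounds m n)).1)
    (hW : Finset.univ.val.map (wl G (wlRounds m n)).2 =
      Finset.univ.val.map (wl G' (wlRounds m n)).2)
    (hj : (wl G (wlRounds m n)).2 j = (wl G' (wlRounds m n)).2 j') :
    ∃ σ τ, IsMILPIso G G' σ τ ∧ τ j = j' := by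
  obtain ⟨σ, hσ⟩ := exists_perm_of_map_univ_eq hV
  obtain ⟨τ₀, hτ₀⟩ := exists_perm_of_map_univ_eq hW
  set τ : Equiv.Perm (Fin n) := τ₀.trans (Equiv.swap (τ₀ j) j') with hτdef
  have hτj : τ j = j' := by simp [hτdef]
  have hτ : ∀ k, (wl G (wlRounds m n)).2 k = (wl G' (wlRounds m n)).2 (τ k) := by
    intro k
    rw [hτ₀ k, hτdef, Equiv.trans_apply]
    by_cases h1 : τ₀ k = τ₀ j
    · rw [h1, Equiv.swap_apply_left, ← hτ₀ j, hj]
    · by_cases h2 : τ₀ k = j'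
      · rw [h2, Equiv.swap_apply_right, ← hj, hτ₀ j]
      · rw [Equiv.swap_apply_of_ne_of_ne h1 h2]
  set H : Bool → MILP m n := fun b => if b then G' else G with hH
  have hσall : ∀ i l, (wl G l).1 i = (wl G' l).1 (σ i) := fun i l =>
    wlAgree_all (H := H) (p := Sum.inl ((false, i), (true, σ i))) (hσ i) l
  have hτall : ∀ k l, (wl G l).2 k = (wl G' l).2 (τ k) := fun k l =>
    wlAgree_all (H := H) (p := Sum.inr ((false, k), (true, τ k))) (hτ k) l
  have hstab : ∀ k k', (wl G (wlRounds m n)).2 k = (wl G (wlRounds m n)).2 k' →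
      ∀ l, (wl G l).2 k = (wl G l).2 k' := fun k k' hk l =>
    wlAgree_all (H := H) (p := Sum.inr ((false, k), (false, k'))) hk l
  have hstab' : ∀ k k', (wl G' (wlRounds m n)).2 k = (wl G' (wlRounds m n)).2 k' →
      ∀ l, (wl G' l).2 k = (wl G' l).2 k' := fun k k' hk l =>
    wlAgree_all (H := H) (p := Sum.inr ((true, k), (true, k'))) hk l
  have hv : ∀ i, (MILP.b G i, MILP.sense G i) = (MILP.b G' (σ i), MILP.sense G' (σ i)) :=
    fun i => hσall i 0
  have hw : ∀ k, (MILP.c G k, MILP.lo G k, MILP.hi G k, MILP.isInt G k) =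
      (MILP.c G' (τ k), MILP.lo G' (τ k), MILP.hi G' (τ k), MILP.isInt G' (τ k)) :=
    fun k => hτall k 0
  simp only [Prod.mk.injEq] at hv hw
  refine ⟨σ, τ, ⟨fun i k => ?_, fun i => (hv i).1, fun i => (hv i).2, fun k => (hw k).1,
    fun k => (hw k).2.1, fun k => (hw k).2.2.1, fun k => (hw k).2.2.2⟩, hτj⟩
  by_cases hA : MILP.A G i k = 0
  · by_cases hA' : MILP.A G' (σ i) (τ k) = 0
    · rw [hA, hA']
    · exact (A_eq_of_wl_eq hG hstab (hσall i _).symm (hτ k).symm hA').symm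
  · exact A_eq_of_wl_eq hG' hstab' (hσall i _) (hτ k) hA

namespace IsMILPIso

variable {m n : ℕ} {G G' : MILP m n} {σ : Equiv.Perm (Fin m)} {τ : Equiv.Perm (Fin n)}

lemma consSat_iff (h : IsMILPIso G G' σ τ) (y : Fin n → ℝ) :
    consSat G' y ↔ consSat G (y ∘ τ) := by
  unfold consSat
  rw [← σ.forall_congr_right]
  refine forall_congr' fun i => ?_
  rw [h.sense_eq, h.b_eq, ← Equiv.sum_comp τ]
  simp only [h.A_eq, Function.comp_apply]

lemma mem_lpFeasSet_iff (h : IsMILPIso G G' σ τ) (y : Fin n → ℝ) :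
    y ∈ lpFeasSet G' ↔ y ∘ τ ∈ lpFeasSet G := by
  refine and_congr (h.consSat_iff y) ?_
  rw [← τ.forall_congr_right]
  simp only [h.lo_eq, h.hi_eq, Function.comp_apply]

lemma mem_feasSetMod_iff (h : IsMILPIso G G' σ τ) (j : Fin n) (l : ExtLo) (u : ExtHi)
    (y : Fin n → ℝ) : y ∈ feasSetMod G' (τ j) l u ↔ y ∘ τ ∈ feasSetMod G j l u := by
  refine and_congr (h.consSat_iff y) (and_congr ?_ Iff.rfl)
  rw [← τ.forall_congr_right]
  simp only [h.lo_eq, h.hi_eq, Function.comp_apply, ne_eq, τ.injective.eq_iff]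

lemma sum_c (h : IsMILPIso G G' σ τ) (y : Fin n → ℝ) :
    ∑ j, MILP.c G' j * y j = ∑ j, MILP.c G j * (y ∘ τ) j := by
  rw [← Equiv.sum_comp τ]
  simp only [h.c_eq, Function.comp_apply]

lemma lpVal_eq (h : IsMILPIso G G' σ τ) {S S' : Set (Fin n → ℝ)}
    (hS : ∀ y, y ∈ S' ↔ y ∘ τ ∈ S) : lpVal (MILP.c G') S' = lpVal (MILP.c G) S := by
  unfold lpVal
  refine Equiv.iInf_congr (Equiv.arrowCongr τ.symm (Equiv.refl ℝ)) fun y => ?_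
  have hy : (Equiv.arrowCongr τ.symm (Equiv.refl ℝ)) y = y ∘ τ := by
    ext
    simp [Equiv.arrowCongr]
  rw [hy, h.sum_c y]
  simp only [hS]

lemma fstar_eq (h : IsMILPIso G G' σ τ) : fstar G' = fstar G :=
  h.lpVal_eq h.mem_lpFeasSet_iff

lemma isOptSol_iff (h : IsMILPIso G G' σ τ) (y : Fin n → ℝ) :
    IsOptSol G' y ↔ IsOptSol G (y ∘ τ) := by
  unfold IsOptSol
  rw [h.mem_lpFeasSet_iff, h.fstar_eq, h.sum_c]

lemma euclNorm_comp (τ : Equiv.Perm (Fin n)) (y : Fin n → ℝ) : euclNorm (y ∘ τ) = euclNorm y := by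
  unfold euclNorm
  rw [← Equiv.sum_comp τ (fun j => y j ^ 2)]
  rfl

lemma isMinNormOpt_comp (h : IsMILPIso G G' σ τ) {y : Fin n → ℝ} (hy : IsMinNormOpt G' y) :
    IsMinNormOpt G (y ∘ τ) := by
  refine ⟨(h.isOptSol_iff y).1 hy.1, fun z hz => ?_⟩
  have hz' : (z ∘ τ.symm) ∘ τ = z := by
    ext
    simp
  have := hy.2 (z ∘ τ.symm) ((h.isOptSol_iff _).2 (hz'.symm ▸ hz))
  rwa [euclNorm_comp, ← euclNorm_comp τ y] at this

end IsMILPIso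

lemma senseRel_midpoint {s : Sense} {a a' b : ℝ} (h : senseRel s a b) (h' : senseRel s a' b) :
    senseRel s ((a + a') / 2) b := by
  unfold senseRel at *
  split_ifs at * <;> linarith

lemma IsOptSol.midpoint {m n : ℕ} {G : MILP m n} {x y : Fin n → ℝ} (hx : IsOptSol G x)
    (hy : IsOptSol G y) : IsOptSol G (fun j => (x j + y j) / 2) := by
  have hlin : ∀ a : Fin n → ℝ, ∑ j, a j * ((x j + y j) / 2) =
      (∑ j, a j * x j + ∑ j, a j * y j) / 2 := fun a => by
    rw [← Finset.sum_add_distrib, Finset.sum_div]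
    exact Finset.sum_congr rfl fun j _ => by ring
  refine ⟨⟨fun i => ?_, fun j => ⟨?_, ?_⟩⟩, ?_⟩
  · rw [hlin]
    exact senseRel_midpoint (hx.1.1 i) (hy.1.1 i)
  · have h1 := (loSat_iff _ _).1 (hx.1.2 j).1
    have h2 := (loSat_iff _ _).1 (hy.1.2 j).1
    rw [loSat_iff]
    linarith
  · have h1 := (hiSat_iff _ _).1 (hx.1.2 j).2
    have h2 := (hiSat_iff _ _).1 (hy.1.2 j).2
    rw [hiSat_iff]
    linarith
  · have h : ∑ j, MILP.c G j * x j = ∑ j, MILP.c G j * y j := by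
      have := hx.2.trans hy.2.symm
      exact_mod_cast this
    rw [hlin, ← h, add_self_div_two, hx.2]

lemma IsMinNormOpt.unique {m n : ℕ} {G : MILP m n} {x y : Fin n → ℝ} (hx : IsMinNormOpt G x)
    (hy : IsMinNormOpt G y) : x = y := by
  have hxy : euclNorm x = euclNorm y := le_antisymm (hx.2 y hy.1) (hy.2 x hx.1)
  have hz := hx.2 _ (hx.1.midpoint hy.1)
  have h0 : ∀ x : Fin n → ℝ, 0 ≤ ∑ j, x j ^ 2 := fun x => Finset.sum_nonneg fun j _ => sq_nonneg _
  have e1 : ∑ j, x j ^ 2 = ∑ j, y j ^ 2 := (Real.sqrt_inj (h0 x) (h0 y)).1 hxy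
  have e2 : ∑ j, x j ^ 2 ≤ ∑ j, ((x j + y j) / 2) ^ 2 := (Real.sqrt_le_sqrt_iff (h0 _)).1 hz
  have e3 : ∑ j, ((x j + y j) / 2) ^ 2 =
      (∑ j, x j ^ 2 + ∑ j, y j ^ 2) / 2 - ∑ j, ((x j - y j) / 2) ^ 2 := by
    rw [← Finset.sum_add_distrib, Finset.sum_div, ← Finset.sum_sub_distrib]
    exact Finset.sum_congr rfl fun j _ => by ring
  have e4 : ∑ j, ((x j - y j) / 2) ^ 2 = 0 :=
    le_antisymm (by linarith) (Finset.sum_nonneg fun j _ => sq_nonneg _)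
  rw [Finset.sum_eq_zero_iff_of_nonneg fun j _ => sq_nonneg _] at e4
  ext j
  have := pow_eq_zero_iff (two_ne_zero) |>.1 (e4 j (Finset.mem_univ j))
  linarith

lemma isMinNormOpt_xstar {m n : ℕ} {G : MILP m n} (h : ∃ x, IsMinNormOpt G x) :
    IsMinNormOpt G (xstar G) := by
  rw [xstar, dif_pos h]
  exact h.choose_spec

lemma IsMILPIso.SB_eq {m n : ℕ} {G G' : MILP m n} {σ : Equiv.Perm (Fin m)}
    {τ : Equiv.Perm (Fin n)} (h : IsMILPIso G G' σ τ) (hG : SBRealValued G) (hG' : SBRealValued G')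
    (j : Fin n) : SB G j = SB G' (τ j) := by
  have hx : xstar G = xstar G' ∘ τ := (isMinNormOpt_xstar hG.1).unique
    (h.isMinNormOpt_comp (isMinNormOpt_xstar hG'.1))
  have hd : branchDown G' (τ j) = branchDown G j := by
    unfold branchDown lpValMod
    rw [hx, h.lo_eq]
    exact h.lpVal_eq (h.mem_feasSetMod_iff j _ _)
  have hu : branchUp G' (τ j) = branchUp G j := by
    unfold branchUp lpValMod
    rw [hx, h.hi_eq]
    exact h.lpVal_eq (h.mem_feasSetMod_iff j _ _)
  unfold SB
  rw [hd, hu, h.isInt_eq, h.fstar_eq]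

/-- The read-out input of the moment network determines the strong branching score. -/
lemma SB_eq_of_readout_eq {m n N : ℕ} (hN : 2 * (m + n) ≤ N) {G G' : MILP m n}
    (hG : MPTractable G) (hG' : MPTractable G') (hS : SBRealValued G) (hS' : SBRealValued G')
    {j j' : Fin n}
    (h : readout N (wlRounds m n + 1) G j = readout N (wlRounds m n + 1) G' j') :
    SB G j = SB G' j' := by
  obtain ⟨hV, hW, hj⟩ := wl_eq_of_readout_eq hN h
  obtain ⟨σ, τ, hiso, rfl⟩ := exists_iso_of_wl_eq hG hG' hV hW hj
  exact hiso.SB_eq hS hS' j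

instance opensMeasurableSpace_sum {α β : Type*} [TopologicalSpace α] [MeasurableSpace α]
    [OpensMeasurableSpace α] [TopologicalSpace β] [MeasurableSpace β] [OpensMeasurableSpace β] :
    OpensMeasurableSpace (α ⊕ β) := ⟨by
  refine MeasurableSpace.generateFrom_le fun s hs => ?_
  exact ⟨(hs.preimage continuous_inl).measurableSet, (hs.preimage continuous_inr).measurableSet⟩⟩

instance opensMeasurableSpace_milp (m n : ℕ) : OpensMeasurableSpace (MILP m n) := by
  have h1 : OpensMeasurableSpace ((Fin n → ExtHi) × (Fin n → Bool)) := inferInstance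
  have h2 : OpensMeasurableSpace ((Fin n → ExtLo) × (Fin n → ExtHi) × (Fin n → Bool)) :=
    inferInstance
  have h3 : OpensMeasurableSpace
      ((Fin m → Sense) × (Fin n → ExtLo) × (Fin n → ExtHi) × (Fin n → Bool)) := inferInstance
  have h4 : OpensMeasurableSpace
      ((Fin n → ℝ) × (Fin m → Sense) × (Fin n → ExtLo) × (Fin n → ExtHi) × (Fin n → Bool)) :=
    inferInstance
  have h5 : OpensMeasurableSpace ((Fin m → ℝ) ×
      (Fin n → ℝ) × (Fin m → Sense) × (Fin n → ExtLo) × (Fin n → ExtHi) × (Fin n → Bool)) :=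
    inferInstance
  have h6 : OpensMeasurableSpace (Fin m → Fin n → ℝ) := inferInstance
  exact Prod.opensMeasurableSpace

instance opensMeasurableSpace_milp_prod (m n : ℕ) : OpensMeasurableSpace (MILP m n × ℝ) :=
  Prod.opensMeasurableSpace

instance opensMeasurableSpace_milp_prod_prod (m n : ℕ) :
    OpensMeasurableSpace (MILP m n × ℝ × ℝ) :=
  Prod.opensMeasurableSpace

lemma measurableSet_exists_of_isClosed {X Y : Type*} [TopologicalSpace X] [MeasurableSpace X]
    [OpensMeasurableSpace X] [TopologicalSpace Y] [SigmaCompactSpace Y] {P : Set (X × Y)}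
    (hP : IsClosed P) : MeasurableSet {x | ∃ y, (x, y) ∈ P} := by
  have h : {x | ∃ y, (x, y) ∈ P} = ⋃ k, Prod.fst ''
      ((fun p : X × compactCovering Y k => (p.1, (p.2 : Y))) ⁻¹' P) := by
    ext x
    simp only [Set.mem_ofPred_eq, Set.mem_iUnion, Set.mem_image, Set.mem_preimage]
    constructor
    · rintro ⟨y, hy⟩
      obtain ⟨k, hk⟩ := exists_mem_compactCovering y
      exact ⟨k, (x, ⟨y, hk⟩), hy, rfl⟩
    · rintro ⟨k, p, hp, rfl⟩
      exact ⟨p.2, hp⟩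
  rw [h]
  refine MeasurableSet.iUnion fun k => IsClosed.measurableSet ?_
  have : CompactSpace (compactCovering Y k) :=
    isCompact_iff_compactSpace.1 (isCompact_compactCovering Y k)
  exact isClosedMap_fst_of_compactSpace _ (hP.preimage (by fun_prop))

/-- The value function of a parametric minimization problem with closed constraints is
measurable. -/
lemma measurable_iInf_of_isClosed {X Y : Type*} [TopologicalSpace X] [MeasurableSpace X]
    [OpensMeasurableSpace X] [TopologicalSpace Y] [SigmaCompactSpace Y] {P : Set (X × Y)}
    (hP : IsClosed P) {c : X × Y → ℝ} (hc : Continuous c) :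
    Measurable fun x => ⨅ (y) (_ : (x, y) ∈ P), ((c (x, y) : ℝ) : EReal) := by
  refine measurable_of_Iio fun t => ?_
  have h : (fun x => ⨅ (y) (_ : (x, y) ∈ P), ((c (x, y) : ℝ) : EReal)) ⁻¹' Set.Iio t =
      ⋃ (q : ℚ) (_ : ((q : ℝ) : EReal) < t), {x | ∃ y, (x, y) ∈ P ∩ {p | c p ≤ q}} := by
    ext x
    simp only [Set.mem_preimage, Set.mem_Iio, iInf_lt_iff, Set.mem_iUnion, Set.mem_ofPred_eq,
      Set.mem_inter_iff]
    constructor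
    · rintro ⟨y, hy, hlt⟩
      obtain ⟨q, hq1, hq2⟩ := EReal.lt_iff_exists_rat_btwn.1 hlt
      exact ⟨q, hq2, y, hy, (EReal.coe_lt_coe_iff.1 hq1).le⟩
    · rintro ⟨q, hq, y, hy, hle⟩
      exact ⟨y, hy, (EReal.coe_le_coe_iff.2 hle).trans_lt hq⟩
  rw [h]
  exact MeasurableSet.iUnion fun q => MeasurableSet.iUnion fun _ =>
    measurableSet_exists_of_isClosed (hP.inter (isClosed_le hc continuous_const))

/-- Lusin's theorem. -/
lemma exists_isCompact_continuousOn {X Y : Type*} [TopologicalSpace X] [T2Space X]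
    [MeasurableSpace X] [OpensMeasurableSpace X] [TopologicalSpace Y] [SecondCountableTopology Y]
    [MeasurableSpace Y] [OpensMeasurableSpace Y] {μ : Measure X} [IsFiniteMeasure μ]
    [μ.InnerRegularCompactLTTop] {f : X → Y} (hf : Measurable f) {S : Set X}
    (hS : MeasurableSet S) {ε : ENNReal} (hε : ε ≠ 0) :
    ∃ K ⊆ S, IsCompact K ∧ ContinuousOn f K ∧ μ (S \ K) ≤ ε := by
  set ι := TopologicalSpace.countableBasis Y with hι
  have hcount : Countable ι := (TopologicalSpace.countable_countableBasis Y).to_subtype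
  have hε2 : ε / 2 ≠ 0 := by simpa using hε
  obtain ⟨δ, hδ, hδsum⟩ := ENNReal.exists_pos_sum_of_countable' hε2 ι
  obtain ⟨K₀, hK₀S, hK₀, hμ₀⟩ := hS.exists_isCompact_sdiff_lt (measure_ne_top μ _) hε2
  have hU : ∀ U : ι, MeasurableSet (f ⁻¹' (U : Set Y)) := fun U =>
    hf (TopologicalSpace.isOpen_of_mem_countableBasis U.2).measurableSet
  have hC : ∀ U : ι, ∃ C ⊆ S ∩ f ⁻¹' U, IsCompact C ∧ μ ((S ∩ f ⁻¹' U) \ C) < δ U / 2 := fun U =>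
    (hS.inter (hU U)).exists_isCompact_sdiff_lt (measure_ne_top μ _) (by simpa using (hδ U).ne')
  have hD : ∀ U : ι, ∃ D ⊆ S \ f ⁻¹' U, IsCompact D ∧ μ ((S \ f ⁻¹' U) \ D) < δ U / 2 := fun U =>
    (hS.diff (hU U)).exists_isCompact_sdiff_lt (measure_ne_top μ _) (by simpa using (hδ U).ne')
  choose C hCsub hCc hCμ using hC
  choose D hDsub hDc hDμ using hD
  refine ⟨K₀ ∩ ⋂ U : ι, (C U ∪ D U), Set.inter_subset_left.trans hK₀S,
    hK₀.inter_right (isClosed_iInter fun U => (hCc U).isClosed.union (hDc U).isClosed), ?_, ?_⟩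
  · intro x hx
    have hb := TopologicalSpace.isBasis_countableBasis Y
    refine (hb.nhds_hasBasis (a := f x)).tendsto_right_iff.2 fun U hxU => ?_
    have hxD : x ∉ D ⟨U, hxU.1⟩ := fun h => (hDsub _ h).2 hxU.2
    filter_upwards [mem_nhdsWithin_of_mem_nhds ((hDc ⟨U, hxU.1⟩).isClosed.isOpen_compl.mem_nhds hxD),
      self_mem_nhdsWithin] with y hy hyK
    rcases Set.mem_iInter.1 hyK.2 ⟨U, hxU.1⟩ with h | h
    · exact (hCsub _ h).2
    · exact absurd h hy
  · have hsub : S \ (K₀ ∩ ⋂ U : ι, (C U ∪ D U)) ⊆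
        (S \ K₀) ∪ ⋃ U : ι, (((S ∩ f ⁻¹' (U : Set Y)) \ C U) ∪ ((S \ f ⁻¹' (U : Set Y)) \ D U)) := by
      rintro x ⟨hxS, hx⟩
      by_cases hx0 : x ∈ K₀
      · right
        have : x ∉ ⋂ U : ι, (C U ∪ D U) := fun h => hx ⟨hx0, h⟩
        simp only [Set.mem_iInter, not_forall] at this
        obtain ⟨U, hUx⟩ := this
        rw [Set.mem_union, not_or] at hUx
        refine Set.mem_iUnion.2 ⟨U, ?_⟩
        by_cases hfx : x ∈ f ⁻¹' (U : Set Y)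
        · exact Or.inl ⟨⟨hxS, hfx⟩, hUx.1⟩
        · exact Or.inr ⟨⟨hxS, hfx⟩, hUx.2⟩
      · exact Or.inl ⟨hxS, hx0⟩
    calc μ (S \ (K₀ ∩ ⋂ U : ι, (C U ∪ D U)))
        ≤ μ (S \ K₀) + ∑' U : ι, μ (((S ∩ f ⁻¹' (U : Set Y)) \ C U) ∪ ((S \ f ⁻¹' (U : Set Y)) \ D U)) :=
          (measure_mono hsub).trans ((measure_union_le _ _).trans
            (add_le_add le_rfl (measure_iUnion_le _)))
      _ ≤ ε / 2 + ∑' U, δ U := by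
          refine add_le_add hμ₀.le (ENNReal.tsum_le_tsum fun U => ?_)
          refine (measure_union_le _ _).trans ?_
          rw [← ENNReal.add_halves (δ U)]
          exact add_le_add (hCμ U).le (hDμ U).le
      _ ≤ ε / 2 + ε / 2 := add_le_add le_rfl hδsum.le
      _ = ε := ENNReal.add_halves ε

/-- A continuous function on a compact space that factors through a continuous map `Φ` is the
composition of `Φ` with a continuous function on the whole target. -/
lemma exists_continuous_factorization {X Z : Type*} [TopologicalSpace X] [CompactSpace X]
    [TopologicalSpace Z] [T2Space Z] [NormalSpace Z] (Φ : C(X, Z)) (h : C(X, ℝ))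
    (hfac : ∀ x y, Φ x = Φ y → h x = h y) : ∃ r : C(Z, ℝ), ∀ x, r (Φ x) = h x := by
  set Ψ : C(X, Set.range Φ) := ⟨Set.rangeFactorization Φ, by fun_prop⟩ with hΨ
  have hq : Topology.IsQuotientMap Ψ :=
    Ψ.continuous.isClosedMap.isQuotientMap Ψ.continuous Set.rangeFactorization_surjective
  have hfac' : Function.FactorsThrough h Ψ := fun x y hxy => hfac x y (congrArg Subtype.val hxy)
  obtain ⟨r, hr⟩ := ContinuousMap.exists_restrict_eq
    (isCompact_range Φ.continuous).isClosed (hq.lift h hfac')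
  refine ⟨r, fun x => ?_⟩
  have h1 := DFunLike.congr_fun hr (Ψ x)
  have h2 := DFunLike.congr_fun (hq.lift_comp h hfac') x
  exact h1.trans h2

lemma isClosed_senseRel {X : Type*} [TopologicalSpace X] {s : X → Sense} {a b : X → ℝ}
    (hs : Continuous s) (ha : Continuous a) (hb : Continuous b) :
    IsClosed {p | senseRel (s p) (a p) (b p)} := by
  set e₁ : Sense → ℝ := fun s => if s = 2 then 0 else 1 with he₁
  set e₂ : Sense → ℝ := fun s => if s = 0 then 0 else 1 with he₂
  have h : {p | senseRel (s p) (a p) (b p)} =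
      {p | e₁ (s p) * a p ≤ e₁ (s p) * b p} ∩ {p | e₂ (s p) * b p ≤ e₂ (s p) * a p} := by
    ext p
    change senseRel (s p) (a p) (b p) ↔
      e₁ (s p) * a p ≤ e₁ (s p) * b p ∧ e₂ (s p) * b p ≤ e₂ (s p) * a p
    generalize s p = t
    fin_cases t
    · simp [senseRel, he₁, he₂]
    · simpa [senseRel, he₁, he₂] using le_antisymm_iff
    · simp [senseRel, he₁, he₂]
  have h₁ : Continuous fun p => e₁ (s p) := (continuous_of_discreteTopology (f := e₁)).comp hs
  have h₂ : Continuous fun p => e₂ (s p) := (continuous_of_discreteTopology (f := e₂)).comp hs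
  rw [h]
  exact (isClosed_le (h₁.mul ha) (h₁.mul hb)).inter (isClosed_le (h₂.mul hb) (h₂.mul ha))

lemma isClosed_loSat {X : Type*} [TopologicalSpace X] {l : X → ExtLo} {x : X → ℝ}
    (hl : Continuous l) (hx : Continuous x) : IsClosed {p | loSat (l p) (x p)} := by
  have h := continuous_boundEnc.comp hl
  simp only [loSat_iff]
  exact isClosed_le h.fst (h.snd.mul hx)

lemma isClosed_hiSat {X : Type*} [TopologicalSpace X] {u : X → ExtHi} {x : X → ℝ}
    (hu : Continuous u) (hx : Continuous x) : IsClosed {p | hiSat (u p) (x p)} := by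
  have h := continuous_boundEnc.comp hu
  simp only [hiSat_iff]
  exact isClosed_le (h.snd.mul hx) h.fst

section Parametric

variable {m n : ℕ} {X : Type*} [TopologicalSpace X] {G : X → MILP m n} {x : X → Fin n → ℝ}

lemma continuous_A (hG : Continuous G) (i : Fin m) (j : Fin n) :
    Continuous fun p => MILP.A (G p) i j := by unfold MILP.A; fun_prop

lemma continuous_lo (hG : Continuous G) (j : Fin n) : Continuous fun p => MILP.lo (G p) j := by
  unfold MILP.lo; fun_prop

lemma continuous_hi (hG : Continuous G) (j : Fin n) : Continuous fun p => MILP.hi (G p) j := by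
  unfold MILP.hi; fun_prop

lemma continuous_objective (hG : Continuous G) (hx : Continuous x) :
    Continuous fun p => ∑ j, MILP.c (G p) j * x p j := by unfold MILP.c; fun_prop

lemma isClosed_consSat (hG : Continuous G) (hx : Continuous x) :
    IsClosed {p | consSat (G p) (x p)} := by
  simp only [consSat, Set.ofPred_forall]
  refine isClosed_iInter fun i => isClosed_senseRel (by unfold MILP.sense; fun_prop)
    (continuous_finsetSum _ fun j _ => (continuous_A hG i j).mul (by fun_prop))
    (by unfold MILP.b; fun_prop)

lemma isClosed_lpFeasSet (hG : Continuous G) (hx : Continuous x) :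
    IsClosed {p | x p ∈ lpFeasSet (G p)} := by
  have h : {p | x p ∈ lpFeasSet (G p)} = {p | consSat (G p) (x p)} ∩
      ⋂ j, ({p | loSat (MILP.lo (G p) j) (x p j)} ∩ {p | hiSat (MILP.hi (G p) j) (x p j)}) := by
    ext p
    simp [lpFeasSet]
  rw [h]
  exact (isClosed_consSat hG hx).inter (isClosed_iInter fun j =>
    (isClosed_loSat (continuous_lo hG j) (by fun_prop)).inter
      (isClosed_hiSat (continuous_hi hG j) (by fun_prop)))

lemma isClosed_feasSetMod (hG : Continuous G) (hx : Continuous x) (j : Fin n) {l : X → ExtLo}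
    {u : X → ExtHi} (hl : Continuous l) (hu : Continuous u) :
    IsClosed {p | x p ∈ feasSetMod (G p) j (l p) (u p)} := by
  have h : {p | x p ∈ feasSetMod (G p) j (l p) (u p)} = {p | consSat (G p) (x p)} ∩
      ((⋂ (j') (_ : j' ≠ j), ({p | loSat (MILP.lo (G p) j') (x p j')} ∩
        {p | hiSat (MILP.hi (G p) j') (x p j')})) ∩
        ({p | loSat (l p) (x p j)} ∩ {p | hiSat (u p) (x p j)})) := by
    ext p
    simp [feasSetMod]
  rw [h]
  exact (isClosed_consSat hG hx).inter ((isClosed_iInter fun j' => isClosed_iInter fun _ =>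
    (isClosed_loSat (continuous_lo hG j') (by fun_prop)).inter
      (isClosed_hiSat (continuous_hi hG j') (by fun_prop))).inter
    ((isClosed_loSat hl (by fun_prop)).inter (isClosed_hiSat hu (by fun_prop))))

lemma continuous_euclNorm : Continuous (euclNorm (n := n)) := by unfold euclNorm; fun_prop

end Parametric

section Measurability

variable {m n : ℕ}

lemma measurable_fstar : Measurable (fstar : MILP m n → EReal) := by
  have hP : IsClosed {p : MILP m n × (Fin n → ℝ) | p.2 ∈ lpFeasSet p.1} :=
    isClosed_lpFeasSet (G := Prod.fst) continuous_fst continuous_snd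
  have hc : Continuous fun p : MILP m n × (Fin n → ℝ) => ∑ j, MILP.c p.1 j * p.2 j :=
    continuous_objective continuous_fst continuous_snd
  have h := measurable_iInf_of_isClosed hP hc
  exact h

lemma measurable_lpValMod_lo (j : Fin n) :
    Measurable fun p : MILP m n × ℝ => lpValMod p.1 j (MILP.lo p.1 j) (Sum.inl p.2) := by
  have hP : IsClosed {q : (MILP m n × ℝ) × (Fin n → ℝ) |
      q.2 ∈ feasSetMod q.1.1 j (MILP.lo q.1.1 j) (Sum.inl q.1.2)} :=
    isClosed_feasSetMod (G := fun q : (MILP m n × ℝ) × (Fin n → ℝ) => q.1.1) (by fun_prop) continuous_snd j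
      (continuous_lo (by fun_prop) j) (continuous_inl.comp (by fun_prop))
  have hc : Continuous fun q : (MILP m n × ℝ) × (Fin n → ℝ) => ∑ j, MILP.c q.1.1 j * q.2 j :=
    continuous_objective (by fun_prop) continuous_snd
  have h := measurable_iInf_of_isClosed hP hc
  exact h

lemma measurable_lpValMod_hi (j : Fin n) :
    Measurable fun p : MILP m n × ℝ => lpValMod p.1 j (Sum.inl p.2) (MILP.hi p.1 j) := by
  have hP : IsClosed {q : (MILP m n × ℝ) × (Fin n → ℝ) |
      q.2 ∈ feasSetMod q.1.1 j (Sum.inl q.1.2) (MILP.hi q.1.1 j)} :=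
    isClosed_feasSetMod (G := fun q : (MILP m n × ℝ) × (Fin n → ℝ) => q.1.1) (by fun_prop) continuous_snd j
      (continuous_inl.comp (by fun_prop)) (continuous_hi (by fun_prop) j)
  have hc : Continuous fun q : (MILP m n × ℝ) × (Fin n → ℝ) => ∑ j, MILP.c q.1.1 j * q.2 j :=
    continuous_objective (by fun_prop) continuous_snd
  have h := measurable_iInf_of_isClosed hP hc
  exact h

/-- The least Euclidean norm of a feasible point of objective value at most `v`. -/
def sublevelNorm (G : MILP m n) (v : ℝ) : EReal :=
  ⨅ (y) (_ : y ∈ lpFeasSet G ∧ ∑ j, MILP.c G j * y j ≤ v), ((euclNorm y : ℝ) : EReal)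

/-- The least value of the `j`-th coordinate on the feasible points of objective value at most `v`
and of Euclidean norm at most `ρ`. -/
def sublevelCoord (G : MILP m n) (v ρ : ℝ) (j : Fin n) : EReal :=
  ⨅ (y) (_ : y ∈ lpFeasSet G ∧ ∑ j, MILP.c G j * y j ≤ v ∧ euclNorm y ≤ ρ), ((y j : ℝ) : EReal)

lemma measurable_sublevelNorm : Measurable fun p : MILP m n × ℝ => sublevelNorm p.1 p.2 := by
  have hP : IsClosed {q : (MILP m n × ℝ) × (Fin n → ℝ) |
      q.2 ∈ lpFeasSet q.1.1 ∧ ∑ j, MILP.c q.1.1 j * q.2 j ≤ q.1.2} :=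
    (isClosed_lpFeasSet (by fun_prop) continuous_snd).inter
      (isClosed_le (continuous_objective (by fun_prop) continuous_snd) (by fun_prop))
  have h := measurable_iInf_of_isClosed hP (continuous_euclNorm.comp continuous_snd)
  exact h

lemma measurable_sublevelCoord (j : Fin n) :
    Measurable fun p : MILP m n × ℝ × ℝ => sublevelCoord p.1 p.2.1 p.2.2 j := by
  have hP : IsClosed {q : (MILP m n × ℝ × ℝ) × (Fin n → ℝ) |
      q.2 ∈ lpFeasSet q.1.1 ∧ ∑ j, MILP.c q.1.1 j * q.2 j ≤ q.1.2.1 ∧ euclNorm q.2 ≤ q.1.2.2} :=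
    (isClosed_lpFeasSet (by fun_prop) continuous_snd).inter
      ((isClosed_le (continuous_objective (by fun_prop) continuous_snd) (by fun_prop)).inter
        (isClosed_le (continuous_euclNorm.comp continuous_snd) (by fun_prop)))
  have h := measurable_iInf_of_isClosed hP ((continuous_apply j).comp continuous_snd)
  exact h

lemma isOptSol_iff {G : MILP m n} (h₁ : fstar G ≠ ⊤) (h₂ : fstar G ≠ ⊥) (y : Fin n → ℝ) :
    IsOptSol G y ↔ y ∈ lpFeasSet G ∧ ∑ j, MILP.c G j * y j ≤ (fstar G).toReal := by
  refine and_congr_right fun hy => ?_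
  have hle : fstar G ≤ ((∑ j, MILP.c G j * y j : ℝ) : EReal) := iInf₂_le y hy
  rw [← EReal.coe_le_coe_iff, EReal.coe_toReal h₁ h₂]
  exact ⟨fun h => h.le, fun h => le_antisymm h hle⟩

lemma abs_le_euclNorm (x : Fin n → ℝ) (j : Fin n) : |x j| ≤ euclNorm x := by
  rw [← Real.sqrt_sq_eq_abs]
  exact Real.sqrt_le_sqrt
    (Finset.single_le_sum (f := fun j => x j ^ 2) (fun _ _ => sq_nonneg _) (Finset.mem_univ j))

lemma norm_le_euclNorm (x : Fin n → ℝ) : ‖x‖ ≤ euclNorm x :=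
  (pi_norm_le_iff_of_nonneg (Real.sqrt_nonneg _)).2 (abs_le_euclNorm x)

lemma exists_isMinNormOpt_iff {G : MILP m n} (h₁ : fstar G ≠ ⊤) (h₂ : fstar G ≠ ⊥) :
    (∃ x, IsMinNormOpt G x) ↔ sublevelNorm G (fstar G).toReal ≠ ⊤ := by
  constructor
  · rintro ⟨x, hx, -⟩
    exact ne_top_of_le_ne_top (EReal.coe_ne_top _) (iInf₂_le x ((isOptSol_iff h₁ h₂ x).1 hx))
  · intro h
    obtain ⟨x₀, hx₀⟩ : ∃ x, IsOptSol G x := by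
      by_contra! hne
      exact h (iInf₂_eq_top.2 fun y hy => absurd ((isOptSol_iff h₁ h₂ y).2 hy) (hne y))
    have hclosed : IsClosed {x | IsOptSol G x} := by
      simp only [isOptSol_iff h₁ h₂]
      exact (isClosed_lpFeasSet continuous_const continuous_id).inter
        (isClosed_le (continuous_objective continuous_const continuous_id) continuous_const)
    have hev : ∀ᶠ x in Filter.cocompact (Fin n → ℝ), euclNorm x₀ ≤ euclNorm x :=
      ((tendsto_norm_cocompact_atTop (E := Fin n → ℝ)).eventually_ge_atTop (euclNorm x₀)).mono
        fun x hx => hx.trans (norm_le_euclNorm x)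
    obtain ⟨x, hx, hmin⟩ := continuous_euclNorm.continuousOn.exists_isMinOn' hclosed
      (show x₀ ∈ {x | IsOptSol G x} from hx₀) (hev.filter_mono inf_le_left)
    exact ⟨x, hx, fun y hy => hmin hy⟩

lemma measurable_sublevelNorm_fstar :
    Measurable fun G : MILP m n => sublevelNorm G (fstar G).toReal := by
  have hv : Measurable fun G : MILP m n => (fstar G).toReal := measurable_fstar.ereal_toReal
  have h := measurable_sublevelNorm.comp (measurable_id.prodMk hv)
  exact h

/-- A measurable function that agrees with `xstar` wherever a minimal norm optimal solution of
finite value exists. -/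
def xstarMeas (G : MILP m n) (j : Fin n) : ℝ :=
  (sublevelCoord G (fstar G).toReal (sublevelNorm G (fstar G).toReal).toReal j).toReal

lemma measurable_xstarMeas (j : Fin n) : Measurable fun G : MILP m n => xstarMeas G j := by
  have hv : Measurable fun G : MILP m n => (fstar G).toReal := measurable_fstar.ereal_toReal
  exact ((measurable_sublevelCoord j).comp (measurable_id.prodMk (hv.prodMk
    measurable_sublevelNorm_fstar.ereal_toReal))).ereal_toReal

lemma xstarMeas_eq {G : MILP m n} (h₁ : fstar G ≠ ⊤) (h₂ : fstar G ≠ ⊥)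
    (h : ∃ x, IsMinNormOpt G x) : xstarMeas G = xstar G := by
  have hx := isMinNormOpt_xstar h
  have hopt := isOptSol_iff h₁ h₂
  have hnorm : sublevelNorm G (fstar G).toReal = (euclNorm (xstar G) : ℝ) :=
    le_antisymm (iInf₂_le (xstar G) ((hopt _).1 hx.1)) (le_iInf₂ fun y hy =>
      EReal.coe_le_coe_iff.2 (hx.2 y ((hopt y).2 hy)))
  funext j
  have hcoord : sublevelCoord G (fstar G).toReal (euclNorm (xstar G)) j = (xstar G j : ℝ) := by
    refine le_antisymm (iInf₂_le (xstar G) ⟨((hopt _).1 hx.1).1, ((hopt _).1 hx.1).2, le_rfl⟩)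
      (le_iInf₂ fun y hy => ?_)
    have hy' : IsMinNormOpt G y :=
      ⟨(hopt y).2 ⟨hy.1, hy.2.1⟩, fun z hz => hy.2.2.trans (hx.2 z hz)⟩
    rw [hy'.unique hx]
  rw [xstarMeas, hnorm, EReal.toReal_coe, hcoord, EReal.toReal_coe]

/-- The function `branchDown` with `xstarMeas` in place of `xstar`. -/
def branchDownMeas (G : MILP m n) (j : Fin n) : EReal :=
  lpValMod G j (MILP.lo G j) (Sum.inl ((⌊xstarMeas G j⌋ : ℤ) : ℝ))

/-- The function `branchUp` with `xstarMeas` in place of `xstar`. -/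
def branchUpMeas (G : MILP m n) (j : Fin n) : EReal :=
  lpValMod G j (Sum.inl ((⌈xstarMeas G j⌉ : ℤ) : ℝ)) (MILP.hi G j)

lemma measurable_branchDownMeas (j : Fin n) :
    Measurable fun G : MILP m n => branchDownMeas G j := by
  have h : Measurable fun G : MILP m n => ((⌊xstarMeas G j⌋ : ℤ) : ℝ) :=
    measurable_from_top.comp (measurable_xstarMeas j).floor
  have h' := (measurable_lpValMod_lo j).comp (measurable_id.prodMk h)
  exact h'

lemma measurable_branchUpMeas (j : Fin n) :
    Measurable fun G : MILP m n => branchUpMeas G j := by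
  have h : Measurable fun G : MILP m n => ((⌈xstarMeas G j⌉ : ℤ) : ℝ) :=
    measurable_from_top.comp (measurable_xstarMeas j).ceil
  have h' := (measurable_lpValMod_hi j).comp (measurable_id.prodMk h)
  exact h'

lemma measurableSet_isInt (j : Fin n) : MeasurableSet {G : MILP m n | MILP.isInt G j = true} := by
  have h : Continuous fun G : MILP m n => MILP.isInt G j := by unfold MILP.isInt; fun_prop
  exact h.measurable (measurableSet_singleton true)

/-- The function `SB` with `xstarMeas` in place of `xstar`. -/
def SBMeas (G : MILP m n) : Fin n → ℝ := fun j =>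
  if MILP.isInt G j then
    ((branchDownMeas G j).toReal - (fstar G).toReal) *
      ((branchUpMeas G j).toReal - (fstar G).toReal)
  else 0

lemma measurable_SBMeas : Measurable (SBMeas : MILP m n → Fin n → ℝ) :=
  measurable_pi_lambda _ fun j => Measurable.ite (measurableSet_isInt j)
    (((measurable_branchDownMeas j).ereal_toReal.sub measurable_fstar.ereal_toReal).mul
      ((measurable_branchUpMeas j).ereal_toReal.sub measurable_fstar.ereal_toReal))
    measurable_const

lemma SBMeas_eq {G : MILP m n} (h : SBRealValued G) : SBMeas G = SB G := by
  obtain ⟨hx, h₁, h₂, -⟩ := h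
  unfold SBMeas SB branchDownMeas branchUpMeas branchDown branchUp
  rw [xstarMeas_eq h₁ h₂ hx]

lemma SBRealValued_iff (G : MILP m n) : SBRealValued G ↔ (fstar G ≠ ⊤ ∧ fstar G ≠ ⊥) ∧
    sublevelNorm G (fstar G).toReal ≠ ⊤ ∧ ∀ j, MILP.isInt G j →
      (branchDownMeas G j ≠ ⊤ ∧ branchDownMeas G j ≠ ⊥) ∧
        branchUpMeas G j ≠ ⊤ ∧ branchUpMeas G j ≠ ⊥ := by
  unfold branchDownMeas branchUpMeas
  constructor
  · rintro ⟨hx, h₁, h₂, h⟩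
    refine ⟨⟨h₁, h₂⟩, (exists_isMinNormOpt_iff h₁ h₂).1 hx, ?_⟩
    rw [xstarMeas_eq h₁ h₂ hx]
    exact fun j hj => and_assoc.2 (h j hj)
  · rintro ⟨⟨h₁, h₂⟩, hx, h⟩
    rw [← exists_isMinNormOpt_iff h₁ h₂] at hx
    rw [xstarMeas_eq h₁ h₂ hx] at h
    exact ⟨hx, h₁, h₂, fun j hj => and_assoc.1 (h j hj)⟩

lemma measurableSet_finite {X : Type*} [MeasurableSpace X] {f : X → EReal} (hf : Measurable f) :
    MeasurableSet {x | f x ≠ ⊤ ∧ f x ≠ ⊥} :=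
  (hf (measurableSet_singleton ⊤)).compl.inter (hf (measurableSet_singleton ⊥)).compl

lemma measurableSet_SBRealValued : MeasurableSet {G : MILP m n | SBRealValued G} := by
  have hn : MeasurableSet {G : MILP m n | sublevelNorm G (fstar G).toReal ≠ ⊤} :=
    (measurable_sublevelNorm_fstar (measurableSet_singleton ⊤)).compl
  have hj : ∀ j, MeasurableSet {G : MILP m n | MILP.isInt G j →
      (branchDownMeas G j ≠ ⊤ ∧ branchDownMeas G j ≠ ⊥) ∧
        branchUpMeas G j ≠ ⊤ ∧ branchUpMeas G j ≠ ⊥} := fun j =>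
    (measurableSet_isInt j).imp ((measurableSet_finite (measurable_branchDownMeas j)).inter
      (measurableSet_finite (measurable_branchUpMeas j)))
  have hj' := MeasurableSet.iInter hj
  rw [← Set.ofPred_forall] at hj'
  simp only [SBRealValued_iff]
  exact (measurableSet_finite measurable_fstar).inter (hn.inter hj')

lemma measurableSet_MPTractable : MeasurableSet {G : MILP m n | MPTractable G} := by
  set N := 2 * (m + n)
  have h : {G : MILP m n | MPTractable G} = ⋂ (i) (i') (j) (j'), {G |
      (∀ l, (feat N G l).1 i = (feat N G l).1 i') → (∀ l, (feat N G l).2 j = (feat N G l).2 j') →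
        MILP.A G i j = MILP.A G i' j'} := by
    ext G
    simp only [MPTractable, Set.mem_iInter, Set.mem_ofPred_eq]
    refine forall₄_congr fun i i' j j' => imp_congr
      (forall_congr' fun l => ((feat_eq_iff le_rfl G G l).1 i i').symm) (imp_congr_left
        (forall_congr' fun l => ((feat_eq_iff le_rfl G G l).2 j j').symm))
  rw [h]
  refine MeasurableSet.iInter fun i => MeasurableSet.iInter fun i' => MeasurableSet.iInter fun j =>
    MeasurableSet.iInter fun j' => ?_
  have h₁ : MeasurableSet {G : MILP m n | ∀ l, (feat N G l).1 i = (feat N G l).1 i'} := by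
    simp only [Set.ofPred_forall]
    exact MeasurableSet.iInter fun l => (isClosed_eq ((continuous_feat N l).1 i)
      ((continuous_feat N l).1 i')).measurableSet
  have h₂ : MeasurableSet {G : MILP m n | ∀ l, (feat N G l).2 j = (feat N G l).2 j'} := by
    simp only [Set.ofPred_forall]
    exact MeasurableSet.iInter fun l => (isClosed_eq ((continuous_feat N l).2 j)
      ((continuous_feat N l).2 j')).measurableSet
  exact h₁.imp (h₂.imp (isClosed_eq (continuous_A continuous_id i j)
    (continuous_A continuous_id i' j')).measurableSet)

/-- On a compact set of MP-tractable instances on which the strong branching scores are finite and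
continuous, they are exactly computed by an MP-GNN. -/
lemma exists_mpgnn_eval_eq_SB {K : Set (MILP m n)} (hK : IsCompact K)
    (hSB : ∀ G ∈ K, SBRealValued G) (hMP : ∀ G ∈ K, MPTractable G) (hcont : ContinuousOn SB K) :
    ∃ F : MPGNN m n, ∀ G ∈ K, MPGNN.eval F G = SB G := by
  have hKc : CompactSpace K := isCompact_iff_compactSpace.1 hK
  set N := 2 * (m + n)
  set L := wlRounds m n + 1
  have hΦ : Continuous fun p : K × Fin n => readout N L (p.1 : MILP m n) p.2 :=
    continuous_prod_of_discrete_right.2 fun j =>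
      (continuous_readout N L j).comp continuous_subtype_val
  have hSBc : Continuous fun p : K × Fin n => SB (p.1 : MILP m n) p.2 :=
    continuous_prod_of_discrete_right.2 fun j =>
      (continuous_apply j).comp (continuousOn_iff_continuous_domRestrict.1 hcont)
  obtain ⟨r, hr⟩ := exists_continuous_factorization ⟨_, hΦ⟩ ⟨_, hSBc⟩ fun p q hpq =>
    SB_eq_of_readout_eq le_rfl (hMP _ p.1.2) (hMP _ q.1.2) (hSB _ p.1.2) (hSB _ q.1.2) hpq
  refine ⟨momentNet m n N L r r.continuous, fun G hG => funext fun j => ?_⟩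
  rw [momentNet_eval]
  exact hr (⟨G, hG⟩, j)

end Measurability

/-- For any Borel regular probability distribution over MILP instances
that is supported on instances with real-valued SB scores and on MP-tractable instances,
MP-GNNs can approximate the strong branching scores to arbitrary accuracy with
arbitrarily high probability. -/
theorem mpgnn_universally_approximates_SB_on_MPTractable
    (m n : ℕ) (hm : 1 ≤ m) (hn : 1 ≤ n)
    (μ : Measure (MILP m n)) (hprob : IsProbabilityMeasure μ) (hreg : μ.Regular)
    (hSB : μ {G | SBRealValued G} = 1)
    (hMP : μ {G | MPTractable G} = 1)
    (ε δ : ℝ) (hε : 0 < ε) (hδ : 0 < δ) :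
    ∃ F : MPGNN m n,
      1 - ENNReal.ofReal ε ≤ μ {G | euclDist (MPGNN.eval F G) (SB G) ≤ δ} := by
  have hS : MeasurableSet {G : MILP m n | SBRealValued G ∧ MPTractable G} :=
    measurableSet_SBRealValued.inter measurableSet_MPTractable
  have hμS : μ {G : MILP m n | SBRealValued G ∧ MPTractable G} = 1 := by
    rw [← mem_ae_iff_prob_eq_one hS]
    exact Filter.inter_mem ((mem_ae_iff_prob_eq_one measurableSet_SBRealValued).2 hSB)
      ((mem_ae_iff_prob_eq_one measurableSet_MPTractable).2 hMP)
  obtain ⟨K, hKS, hK, hcont, hμK⟩ := exists_isCompact_continuousOn (μ := μ)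
    (measurable_SBMeas (m := m) (n := n)) hS (ENNReal.ofReal_pos.2 hε).ne'
  obtain ⟨F, hF⟩ := exists_mpgnn_eval_eq_SB hK (fun G hG => (hKS hG).1) (fun G hG => (hKS hG).2)
    (hcont.congr fun G hG => (SBMeas_eq (hKS hG).1).symm)
  refine ⟨F, (?_ : 1 - ENNReal.ofReal ε ≤ μ K).trans (measure_mono fun G hG => ?_)⟩
  · rw [tsub_le_iff_right, ← hμS]
    calc μ {G : MILP m n | SBRealValued G ∧ MPTractable G}
        ≤ μ (K ∪ ({G : MILP m n | SBRealValued G ∧ MPTractable G} \ K)) :=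
          measure_mono (Set.sdiff_subset_iff.1 subset_rfl)
      _ ≤ μ K + ENNReal.ofReal ε := (measure_union_le _ _).trans (add_le_add le_rfl hμK)
  · simp [euclDist, euclNorm, hF G hG, hδ.le]
end
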